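/- Let d ≥ 1, 1 < q < d+2, β ∈ (1, (d+2)/q]. Then there exists a constant N = N(d, q, β) such that for every measurable vector field b = (b^1, …, b^d) on ℝ^{d+1} and every u ∈ C_0^∞(ℝ^{d+1}) one has ‖b^i D_i u‖_{E_{q, β}} ≤ N ‖ |b| ‖_{E_{βq, 1}} ‖∂_t u + Δu‖_{E_{q, β}} (summation over i). -/

import Mathlib

open MeasureTheory Set ENNReal Filter

noncomputable section

/-- Euclidean space `ℝ^d`. -/
abbrev Ed (d : ℕ) := EuclideanSpace ℝ (Fin d)

/-- Points of `ℝ^{d+1}`: `z = (t, x)`. -/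
abbrev Pt (d : ℕ) := ℝ × Ed d

/-- The parabolic cylinder `C_ρ(t,x)`. -/
def pCyl (d : ℕ) (ρ : ℝ) (z : Pt d) : Set (Pt d) :=
  {w | dist z.2 w.2 < ρ ∧ z.1 ≤ w.1 ∧ w.1 < z.1 + ρ ^ 2}

/-- The average `⨍_{C_ρ(z)} f`. -/
def pAvg (d : ℕ) (ρ : ℝ) (z : Pt d) (f : Pt d → ℝ≥0∞) : ℝ≥0∞ :=
  (volume (pCyl d ρ z))⁻¹ * ∫⁻ w in pCyl d ρ z, f w

/-- The fractional maximal function `M_β f`. -/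
def Mbeta (d : ℕ) (β : ℝ) (f : Pt d → ℝ≥0∞) (z : Pt d) : ℝ≥0∞ :=
  ⨆ (ρ : ℝ) (_ : 0 < ρ), ENNReal.ofReal (ρ ^ β) * pAvg d ρ z f

/-- The kernel `p_α(s, r)`. -/
def pKer (d : ℕ) (α : ℝ) (s r : ℝ) : ℝ≥0∞ :=
  if 0 < s then ENNReal.ofReal (s ^ (-(((d : ℝ) + 2 - α) / 2)) * Real.exp (-(r ^ 2) / s)) else 0

/-- The parabolic potential `P_α f`. -/
def Palpha (d : ℕ) (α : ℝ) (f : Pt d → ℝ≥0∞) (z : Pt d) : ℝ≥0∞ :=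
  ∫⁻ w : Pt d, pKer d α w.1 ‖w.2‖ * f (z.1 + w.1, z.2 + w.2)

/-- The parabolic Morrey norm `‖f‖_{E_{p,β}(Q)}`. -/
def MorreyNorm (d : ℕ) (p β : ℝ) (Q : Set (Pt d)) (f : Pt d → ℝ≥0∞) : ℝ≥0∞ :=
  ⨆ (ρ : ℝ) (_ : 0 < ρ) (z : Pt d) (_ : z ∈ Q),
    ENNReal.ofReal (ρ ^ β) * (pAvg d ρ z fun w => Q.indicator f w ^ p) ^ (1 / p)

/-- The `L_p`-norm on `ℝ^{d+1}`. -/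
def LpNormE (d : ℕ) (p : ℝ) (f : Pt d → ℝ≥0∞) : ℝ≥0∞ :=
  (∫⁻ z : Pt d, f z ^ p) ^ (1 / p)

/-- The mixed norm `‖f‖_{L_{q₁,q₂}}`. -/
def MixedNorm (d : ℕ) (q₁ q₂ : ℝ) (f : Pt d → ℝ≥0∞) : ℝ≥0∞ :=
  (∫⁻ t : ℝ, (∫⁻ x : Ed d, f (t, x) ^ q₁) ^ (q₂ / q₁)) ^ (1 / q₂)

/-- The normalized mixed norm `‖f‖_{L_{q₁,q₂}(Γ)}`. -/
def MixedNormOn (d : ℕ) (q₁ q₂ : ℝ) (Γ : Set (Pt d)) (f : Pt d → ℝ≥0∞) : ℝ≥0∞ :=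
  (MixedNorm d q₁ q₂ (Γ.indicator 1))⁻¹ * MixedNorm d q₁ q₂ (Γ.indicator f)

/-- The mixed-norm parabolic Morrey norm `‖f‖_{E_{q₁,q₂,β}(Q)}`. -/
def MixedMorrey (d : ℕ) (q₁ q₂ β : ℝ) (Q : Set (Pt d)) (f : Pt d → ℝ≥0∞) : ℝ≥0∞ :=
  ⨆ (ρ : ℝ) (_ : 0 < ρ) (z : Pt d) (_ : z ∈ Q),
    ENNReal.ofReal (ρ ^ β) * MixedNormOn d q₁ q₂ (pCyl d ρ z) (Q.indicator f)

/-- The symmetric parabolic maximal function `M̂ f`. -/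
def pMax (d : ℕ) (f : Pt d → ℝ≥0∞) (z : Pt d) : ℝ≥0∞ :=
  ⨆ (r : ℝ) (_ : 0 < r) (w : Pt d) (_ : z ∈ pCyl d r w), pAvg d r w f

/-- The time derivative `∂_t u`. -/
def timeDeriv (d : ℕ) (u : Pt d → ℝ) (z : Pt d) : ℝ :=
  fderiv ℝ u z ((1 : ℝ), (0 : Ed d))

/-- The spatial partial derivative `D_i u`. -/
def spDeriv (d : ℕ) (i : Fin d) (u : Pt d → ℝ) (z : Pt d) : ℝ :=
  fderiv ℝ u z ((0 : ℝ), EuclideanSpace.single i (1 : ℝ))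

/-- The Euclidean norm of the spatial gradient `|Du|`. -/
def gradNorm (d : ℕ) (u : Pt d → ℝ) (z : Pt d) : ℝ :=
  Real.sqrt (∑ i : Fin d, spDeriv d i u z ^ 2)

/-- The spatial Laplacian `Δu`. -/
def lap (d : ℕ) (u : Pt d → ℝ) (z : Pt d) : ℝ :=
  ∑ i : Fin d, spDeriv d i (spDeriv d i u) z

/-- The (Frobenius) norm of the spatial Hessian `|D²u|`. -/
def hessNorm (d : ℕ) (u : Pt d → ℝ) (z : Pt d) : ℝ :=
  Real.sqrt (∑ i : Fin d, ∑ j : Fin d, spDeriv d i (spDeriv d j u) z ^ 2)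


/-- The symmetric open parabolic cylinder. -/
def symQ (d : ℕ) (r : ℝ) (z : Pt d) : Set (Pt d) :=
  {w | dist z.2 w.2 < r ∧ |w.1 - z.1| < r ^ 2}

/-- volume of the unit ball -/
def kap (d : ℕ) : ℝ≥0∞ := volume (Metric.ball (0 : Ed d) 1)

lemma kap_ne_zero (d : ℕ) : kap d ≠ 0 := (Metric.measure_ball_pos _ _ one_pos).ne'
lemma kap_ne_top (d : ℕ) : kap d ≠ ⊤ := measure_ball_lt_top.ne

lemma symQ_eq (d : ℕ) (r : ℝ) (z : Pt d) :
    symQ d r z = Ioo (z.1 - r ^ 2) (z.1 + r ^ 2) ×ˢ Metric.ball z.2 r := by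
  ext w
  simp only [symQ, mem_ofPred_eq, mem_prod, mem_Ioo, Metric.mem_ball, abs_lt, dist_comm z.2]
  constructor
  · rintro ⟨a, b, c⟩; exact ⟨⟨by linarith, by linarith⟩, a⟩
  · rintro ⟨⟨b, c⟩, a⟩; exact ⟨a, by linarith, by linarith⟩

lemma pCyl_eq (d : ℕ) (r : ℝ) (z : Pt d) :
    pCyl d r z = Ico z.1 (z.1 + r ^ 2) ×ˢ Metric.ball z.2 r := by
  ext w
  simp only [pCyl, mem_ofPred_eq, mem_prod, mem_Ico, Metric.mem_ball, dist_comm z.2]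
  tauto

lemma isOpen_symQ (d : ℕ) (r : ℝ) (z : Pt d) : IsOpen (symQ d r z) := by
  rw [symQ_eq]; exact isOpen_Ioo.prod Metric.isOpen_ball

lemma measurableSet_pCyl (d : ℕ) (r : ℝ) (z : Pt d) : MeasurableSet (pCyl d r z) := by
  rw [pCyl_eq]; exact measurableSet_Ico.prod measurableSet_ball

lemma self_mem_symQ {d : ℕ} {r : ℝ} (hr : 0 < r) (z : Pt d) : z ∈ symQ d r z := by
  simp only [symQ, mem_ofPred_eq, dist_self, sub_self, abs_zero]
  exact ⟨hr, by positivity⟩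

lemma volume_symQ (d : ℕ) {r : ℝ} (hr : 0 < r) (z : Pt d) :
    volume (symQ d r z) = ENNReal.ofReal (2 * r ^ (d + 2)) * kap d := by
  rw [symQ_eq, Measure.volume_eq_prod, Measure.prod_prod, Real.volume_Ioo,
    Measure.addHaar_ball_of_pos _ _ hr, ← mul_assoc, ← ENNReal.ofReal_mul (by nlinarith [sq_nonneg r])]
  congr 2
  simp
  ring

lemma volume_pCyl (d : ℕ) {r : ℝ} (hr : 0 < r) (z : Pt d) :
    volume (pCyl d r z) = ENNReal.ofReal (r ^ (d + 2)) * kap d := by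
  rw [pCyl_eq, Measure.volume_eq_prod, Measure.prod_prod, Real.volume_Ico,
    Measure.addHaar_ball_of_pos _ _ hr, ← mul_assoc, ← ENNReal.ofReal_mul (by nlinarith [sq_nonneg r])]
  congr 2
  simp
  ring

lemma volume_symQ_ne_zero (d : ℕ) {r : ℝ} (hr : 0 < r) (z : Pt d) : volume (symQ d r z) ≠ 0 := by
  rw [volume_symQ d hr]
  exact mul_ne_zero (by simp; positivity) (kap_ne_zero d)

lemma volume_symQ_ne_top (d : ℕ) {r : ℝ} (hr : 0 < r) (z : Pt d) : volume (symQ d r z) ≠ ⊤ := by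
  rw [volume_symQ d hr]
  exact ENNReal.mul_ne_top ENNReal.ofReal_ne_top (kap_ne_top d)

lemma volume_pCyl_ne_zero (d : ℕ) {r : ℝ} (hr : 0 < r) (z : Pt d) : volume (pCyl d r z) ≠ 0 := by
  rw [volume_pCyl d hr]
  exact mul_ne_zero (by simp; positivity) (kap_ne_zero d)

lemma volume_pCyl_ne_top (d : ℕ) {r : ℝ} (hr : 0 < r) (z : Pt d) : volume (pCyl d r z) ≠ ⊤ := by
  rw [volume_pCyl d hr]
  exact ENNReal.mul_ne_top ENNReal.ofReal_ne_top (kap_ne_top d)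

lemma volume_symQ_mul (d : ℕ) {r c : ℝ} (hc : 0 < c) (hr : 0 < r) (z w : Pt d) :
    volume (symQ d (c * r) z) = ENNReal.ofReal (c ^ (d + 2)) * volume (symQ d r w) := by
  rw [volume_symQ d hr, volume_symQ d (by positivity), ← mul_assoc,
    ← ENNReal.ofReal_mul (by positivity)]
  congr 2
  rw [mul_pow]; ring

/-- Average over the symmetric cylinder. -/
def qAvg (d : ℕ) (r : ℝ) (z : Pt d) (f : Pt d → ℝ≥0∞) : ℝ≥0∞ :=
  (volume (symQ d r z))⁻¹ * ∫⁻ w in symQ d r z, f w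

/-- Uncentered maximal function over symmetric cylinders. -/
def maxQ (d : ℕ) (f : Pt d → ℝ≥0∞) (z : Pt d) : ℝ≥0∞ :=
  ⨆ (r : ℝ) (_ : 0 < r) (w : Pt d) (_ : z ∈ symQ d r w), qAvg d r w f

lemma lt_maxQ {d : ℕ} {f : Pt d → ℝ≥0∞} {z : Pt d} {l : ℝ≥0∞} :
    l < maxQ d f z ↔ ∃ r w, 0 < r ∧ z ∈ symQ d r w ∧ l < qAvg d r w f := by
  simp only [maxQ, lt_iSup_iff]
  constructor
  · rintro ⟨r, hr, w, hw, h⟩; exact ⟨r, w, hr, hw, h⟩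
  · rintro ⟨r, w, hr, hw, h⟩; exact ⟨r, hr, w, hw, h⟩

lemma qAvg_le_maxQ {d : ℕ} {f : Pt d → ℝ≥0∞} {z w : Pt d} {r : ℝ} (hr : 0 < r)
    (h : z ∈ symQ d r w) : qAvg d r w f ≤ maxQ d f z :=
  le_iSup_of_le r <| le_iSup_of_le hr <| le_iSup_of_le w <| le_iSup_of_le h le_rfl

lemma maxQ_le {d : ℕ} {f : Pt d → ℝ≥0∞} {z : Pt d} {C : ℝ≥0∞}
    (h : ∀ r w, 0 < r → z ∈ symQ d r w → qAvg d r w f ≤ C) : maxQ d f z ≤ C :=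
  iSup_le fun r => iSup_le fun hr => iSup_le fun w => iSup_le fun hw => h r w hr hw

lemma isOpen_lt_maxQ (d : ℕ) (f : Pt d → ℝ≥0∞) (l : ℝ≥0∞) : IsOpen {z | l < maxQ d f z} := by
  have : {z | l < maxQ d f z} = ⋃ (r : ℝ) (w : Pt d) (_ : 0 < r ∧ l < qAvg d r w f), symQ d r w := by
    ext z
    simp only [mem_ofPred_eq, lt_maxQ, mem_iUnion, exists_prop]
    constructor
    · rintro ⟨r, w, hr, hw, h⟩; exact ⟨r, w, ⟨hr, h⟩, hw⟩
    · rintro ⟨r, w, ⟨hr, h⟩, hw⟩; exact ⟨r, w, hr, hw, h⟩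
  rw [this]
  exact isOpen_iUnion fun r => isOpen_iUnion fun w => isOpen_iUnion fun _ => isOpen_symQ d r w

lemma measurable_maxQ (d : ℕ) (f : Pt d → ℝ≥0∞) : Measurable (maxQ d f) :=
  measurable_of_Ioi fun l => (isOpen_lt_maxQ d f l).measurableSet

lemma qAvg_const_le {d : ℕ} {f : Pt d → ℝ≥0∞} {B : ℝ≥0∞} (hB : ∀ z, f z ≤ B) {r : ℝ} (hr : 0 < r)
    (w : Pt d) : qAvg d r w f ≤ B := by
  unfold qAvg
  calc _ ≤ (volume (symQ d r w))⁻¹ * ∫⁻ _ in symQ d r w, B := by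
        gcongr; exact hB _
    _ = B := by
        rw [setLIntegral_const, mul_comm B, ← mul_assoc,
          ENNReal.inv_mul_cancel (volume_symQ_ne_zero d hr w) (volume_symQ_ne_top d hr w), one_mul]

lemma symQ_subset {d : ℕ} {ra rb : ℝ} {wa wb : Pt d} (hra : 0 < ra) (h : ra ≤ 2 * rb)
    (hne : (symQ d ra wa ∩ symQ d rb wb).Nonempty) : symQ d ra wa ⊆ symQ d (5 * rb) wb := by
  obtain ⟨p, ⟨h1, h2⟩, ⟨h3, h4⟩⟩ := hne
  rintro y ⟨h5, h6⟩
  refine ⟨?_, ?_⟩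
  · have := dist_triangle4 wb.2 p.2 wa.2 y.2
    rw [dist_comm p.2] at this
    linarith
  · rw [abs_lt] at *
    constructor <;> nlinarith

lemma weak_type (d : ℕ) (f : Pt d → ℝ≥0∞) {l : ℝ≥0∞} (hl : l ≠ 0) (hl' : l ≠ ⊤) :
    l * volume {z | l < maxQ d f z} ≤ ENNReal.ofReal (5 ^ (d + 2)) * ∫⁻ z, f z := by
  by_cases hI : ∫⁻ z, f z = ⊤
  · rw [hI, ENNReal.mul_top (by simp)]; exact le_top
  set t : Set (ℝ × Pt d) := {a | 0 < a.1 ∧ l < qAvg d a.1 a.2 f} with ht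
  have key : ∀ a ∈ t, l * volume (symQ d a.1 a.2) ≤ ∫⁻ w in symQ d a.1 a.2, f w := by
    rintro a ⟨ha, ha'⟩
    have := (ENNReal.mul_lt_mul_iff_left (volume_symQ_ne_zero d ha a.2)
      (volume_symQ_ne_top d ha a.2)).2 ha'
    unfold qAvg at this
    rw [mul_comm (volume _)⁻¹, mul_assoc,
      ENNReal.inv_mul_cancel (volume_symQ_ne_zero d ha a.2) (volume_symQ_ne_top d ha a.2),
      mul_one] at this
    exact this.le
  obtain ⟨R, hR⟩ : ∃ R : ℝ, ∀ a ∈ t, a.1 ≤ R := by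
    set I := (∫⁻ z, f z) / (l * kap d) with hIdef
    have hItop : I ≠ ⊤ := ENNReal.div_ne_top hI (mul_ne_zero hl (kap_ne_zero d))
    refine ⟨max 1 I.toReal, fun a ha => ?_⟩
    by_contra hcon
    push Not at hcon
    have h1 : 1 < a.1 := lt_of_le_of_lt (le_max_left _ _) hcon
    have h2 : I.toReal < a.1 := lt_of_le_of_lt (le_max_right _ _) hcon
    have h3 := (key a ha).trans (setLIntegral_le_lintegral _ _)
    rw [volume_symQ d ha.1] at h3
    have h4 : ENNReal.ofReal (2 * a.1 ^ (d + 2)) ≤ I := by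
      rw [hIdef, ENNReal.le_div_iff_mul_le (Or.inl (mul_ne_zero hl (kap_ne_zero d)))
        (Or.inl (ENNReal.mul_ne_top hl' (kap_ne_top d)))]
      calc _ = _ := by ring
        _ ≤ _ := h3
    have h5 := (ENNReal.ofReal_le_iff_le_toReal hItop).1 h4
    have h6 : a.1 ≤ a.1 ^ (d + 2) := le_self_pow₀ h1.le (by omega)
    linarith
  obtain ⟨u, hut, hdis, hcov⟩ := Vitali.exists_disjoint_subfamily_covering_enlargement
    (fun a : ℝ × Pt d => symQ d a.1 a.2) t (fun a => a.1) 2 one_lt_two (fun a ha => ha.1.le) R hR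
    (fun a ha => ⟨a.2, self_mem_symQ ha.1 a.2⟩)
  have hcount : u.Countable := hdis.countable_of_isOpen (fun a _ => isOpen_symQ d _ _)
    (fun a ha => ⟨a.2, self_mem_symQ (hut ha).1 a.2⟩)
  have hsub : {z | l < maxQ d f z} ⊆ ⋃ a ∈ u, symQ d (5 * a.1) a.2 := by
    intro z hz
    obtain ⟨r, w, hr, hzw, h⟩ := lt_maxQ.1 hz
    obtain ⟨b, hb, hne, hle⟩ := hcov (r, w) ⟨hr, h⟩
    exact mem_biUnion hb (symQ_subset hr hle hne hzw)
  calc l * volume {z | l < maxQ d f z} ≤ l * volume (⋃ a ∈ u, symQ d (5 * a.1) a.2) := by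
        gcongr
    _ ≤ l * ∑' a : u, volume (symQ d (5 * a.1.1) a.1.2) := by
        gcongr
        exact measure_biUnion_le _ hcount _
    _ = ENNReal.ofReal (5 ^ (d + 2)) * ∑' a : u, l * volume (symQ d a.1.1 a.1.2) := by
        rw [← ENNReal.tsum_mul_left, ← ENNReal.tsum_mul_left]
        congr 1; ext a
        rw [volume_symQ_mul d (by norm_num) (hut a.2).1 a.1.2 a.1.2]; ring
    _ ≤ ENNReal.ofReal (5 ^ (d + 2)) * ∑' a : u, ∫⁻ w in symQ d a.1.1 a.1.2, f w := by
        gcongr with a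
        exact key _ (hut a.2)
    _ = ENNReal.ofReal (5 ^ (d + 2)) * ∫⁻ w in ⋃ a ∈ u, symQ d a.1 a.2, f w := by
        rw [lintegral_biUnion hcount (fun a _ => (isOpen_symQ d _ _).measurableSet) hdis]
    _ ≤ _ := by
        gcongr
        exact Measure.restrict_le_self

lemma level_bound (d : ℕ) (g : Pt d → ℝ) (hg : Measurable g)
    {t : ℝ} (ht : 0 < t) :
    ENNReal.ofReal (t / 2) * volume {z | ENNReal.ofReal t < maxQ d (fun z => ENNReal.ofReal (g z)) z}
      ≤ ENNReal.ofReal (5 ^ (d + 2)) *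
        (volume.withDensity (fun z => ENNReal.ofReal (g z))) {z | t < 2 * g z} := by
  have hS : MeasurableSet {z | t < 2 * g z} := measurableSet_lt measurable_const (hg.const_mul 2)
  set G : Pt d → ℝ≥0∞ := fun z => ENNReal.ofReal (g z) with hG
  set Gt := indicator {z | t < 2 * g z} G with hGt
  have hle : ∀ z, G z ≤ Gt z + ENNReal.ofReal (t / 2) := by
    intro z
    by_cases hz : z ∈ {z | t < 2 * g z}
    · rw [hGt, indicator_of_mem hz]; exact le_self_add
    · rw [hGt, indicator_of_notMem hz, zero_add]
      apply ENNReal.ofReal_le_ofReal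
      have : ¬ (t < 2 * g z) := hz
      linarith
  have hsub : {z | ENNReal.ofReal t < maxQ d G z} ⊆ {z | ENNReal.ofReal (t / 2) < maxQ d Gt z} := by
    intro z hz
    obtain ⟨r, w, hr, hzw, h⟩ := lt_maxQ.1 hz
    refine lt_maxQ.2 ⟨r, w, hr, hzw, ?_⟩
    by_contra hcon
    push Not at hcon
    have : qAvg d r w G ≤ qAvg d r w Gt + ENNReal.ofReal (t / 2) := by
      unfold qAvg
      calc _ ≤ (volume (symQ d r w))⁻¹ * ∫⁻ y in symQ d r w, (Gt y + ENNReal.ofReal (t / 2)) := by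
            gcongr; exact hle _
        _ = _ := by
            rw [lintegral_add_right _ measurable_const, mul_add]
            congr 1
            rw [setLIntegral_const, mul_comm (ENNReal.ofReal _), ← mul_assoc,
              ENNReal.inv_mul_cancel (volume_symQ_ne_zero d hr w) (volume_symQ_ne_top d hr w),
              one_mul]
    have h2 : qAvg d r w G ≤ ENNReal.ofReal t := by
      calc _ ≤ _ := this
        _ ≤ ENNReal.ofReal (t / 2) + ENNReal.ofReal (t / 2) := by gcongr
        _ = _ := by rw [← ENNReal.ofReal_add (by positivity) (by positivity)]; congr 1; ring
    exact absurd h (not_lt.2 h2)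
  calc _ ≤ ENNReal.ofReal (t / 2) * volume {z | ENNReal.ofReal (t / 2) < maxQ d Gt z} := by gcongr
    _ ≤ _ := weak_type d Gt (by simpa using ht) ENNReal.ofReal_ne_top
    _ = _ := by
      rw [withDensity_apply _ hS, hGt, lintegral_indicator hS]

lemma strong_type (d : ℕ) {q : ℝ} (hq : 1 < q) : ∃ C : ℝ≥0∞, C ≠ ⊤ ∧
    ∀ (g : Pt d → ℝ) (B : ℝ), Measurable g → (∀ z, 0 ≤ g z) → (∀ z, g z ≤ B) →
      ∫⁻ z, maxQ d (fun z => ENNReal.ofReal (g z)) z ^ q ≤ C * ∫⁻ z, ENNReal.ofReal (g z) ^ q := by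
  refine ⟨ENNReal.ofReal q * (ENNReal.ofReal (5 ^ (d + 2)) * 2 * ((ENNReal.ofReal (q - 1))⁻¹ *
    ENNReal.ofReal (2 ^ (q - 1)))), ?_, ?_⟩
  · have : (ENNReal.ofReal (q - 1))⁻¹ ≠ ⊤ := by simpa using hq
    finiteness
  intro g B hg hg0 hgB
  set G : Pt d → ℝ≥0∞ := fun z => ENNReal.ofReal (g z) with hG
  have hGm : Measurable G := hg.ennreal_ofReal
  have hMB : ∀ z, maxQ d G z ≤ ENNReal.ofReal B := fun z =>
    maxQ_le fun r w hr _ => qAvg_const_le (fun z => ENNReal.ofReal_le_ofReal (hgB z)) hr w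
  have hMt : ∀ z, maxQ d G z ≠ ⊤ := fun z => ((hMB z).trans_lt ENNReal.ofReal_lt_top).ne
  set ν := volume.withDensity G with hν
  have e1 : ∫⁻ z, maxQ d G z ^ q = ∫⁻ z, ENNReal.ofReal ((maxQ d G z).toReal ^ q) := by
    congr 1; ext z
    rw [← ENNReal.ofReal_rpow_of_nonneg ENNReal.toReal_nonneg (by linarith),
      ENNReal.ofReal_toReal (hMt z)]
  rw [e1, lintegral_rpow_eq_lintegral_meas_lt_mul _ (Eventually.of_forall fun z => ENNReal.toReal_nonneg)
    (measurable_maxQ d G).ennreal_toReal.aemeasurable (by linarith), mul_assoc]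
  gcongr
  have e2 : ∀ t ∈ Ioi (0:ℝ), volume {a | t < (maxQ d G a).toReal} * ENNReal.ofReal (t ^ (q - 1)) ≤
      ENNReal.ofReal (5 ^ (d + 2)) * 2 * (ν {a | t < 2 * g a} * ENNReal.ofReal (t ^ (q - 1 - 1))) := by
    intro t ht
    have ht : 0 < t := ht
    have := level_bound d g hg ht
    have s1 : {a | t < (maxQ d G a).toReal} = {z | ENNReal.ofReal t < maxQ d G z} := by
      ext z; exact (ENNReal.ofReal_lt_iff_lt_toReal ht.le (hMt z)).symm
    have s2 : ENNReal.ofReal (t ^ (q - 1)) =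
        ENNReal.ofReal (t / 2) * (2 * ENNReal.ofReal (t ^ (q - 1 - 1))) := by
      rw [show (2:ℝ≥0∞) = ENNReal.ofReal 2 by simp, ← ENNReal.ofReal_mul (by norm_num),
        ← ENNReal.ofReal_mul (by positivity), Real.rpow_sub_one ht.ne' (q - 1)]
      congr 1; field_simp
    rw [s1, s2]
    calc _ = (ENNReal.ofReal (t / 2) * volume {z | ENNReal.ofReal t < maxQ d G z}) *
          (2 * ENNReal.ofReal (t ^ (q - 1 - 1))) := by ring
      _ ≤ (ENNReal.ofReal (5 ^ (d + 2)) * ν {z | t < 2 * g z}) *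
          (2 * ENNReal.ofReal (t ^ (q - 1 - 1))) := by gcongr
      _ = _ := by ring
  have hq1 : 0 < q - 1 := by linarith
  have e3 := lintegral_rpow_eq_lintegral_meas_lt_mul ν (f := fun z => 2 * g z)
    (Eventually.of_forall fun z => mul_nonneg zero_le_two (hg0 z)) (hg.const_mul 2).aemeasurable hq1
  calc _ ≤ ∫⁻ t in Ioi (0:ℝ), ENNReal.ofReal (5 ^ (d + 2)) * 2 *
        (ν {a | t < 2 * g a} * ENNReal.ofReal (t ^ (q - 1 - 1))) := 
        setLIntegral_mono' measurableSet_Ioi e2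
    _ = ENNReal.ofReal (5 ^ (d + 2)) * 2 *
        ∫⁻ t in Ioi (0:ℝ), (ν {a | t < 2 * g a} * ENNReal.ofReal (t ^ (q - 1 - 1))) := by
        rw [lintegral_const_mul' _ _ (by finiteness)]
    _ = ENNReal.ofReal (5 ^ (d + 2)) * 2 * ((ENNReal.ofReal (q - 1))⁻¹ *
        ∫⁻ z, ENNReal.ofReal ((2 * g z) ^ (q - 1)) ∂ν) := by
        rw [e3, ← mul_assoc _ (ENNReal.ofReal (q - 1)), ENNReal.inv_mul_cancel (by simpa using hq)
          ENNReal.ofReal_ne_top, one_mul]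
    _ = _ := by
        rw [hν, lintegral_withDensity_eq_lintegral_mul _ hGm (by fun_prop)]
        rw [mul_assoc (ENNReal.ofReal (5 ^ (d + 2)) * 2), mul_assoc (ENNReal.ofReal (q - 1))⁻¹,
          ← lintegral_const_mul' _ _ ENNReal.ofReal_ne_top]
        congr 3; ext z
        simp only [Pi.mul_apply, hG]
        rw [ENNReal.ofReal_rpow_of_nonneg (hg0 z) (by linarith), ← ENNReal.ofReal_mul (hg0 z),
          ← ENNReal.ofReal_mul (by positivity)]
        congr 1
        rw [Real.mul_rpow (by norm_num) (hg0 z)]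
        rcases (hg0 z).eq_or_lt with h | h
        · rw [← h, Real.zero_rpow (by linarith : q ≠ 0)]; simp
        · rw [Real.rpow_sub_one h.ne']; field_simp

lemma pAvg_le_morrey {d : ℕ} {q β : ℝ} (hq : 1 < q) (G : Pt d → ℝ≥0∞) {ρ : ℝ} (hρ : 0 < ρ)
    (z : Pt d) :
    pAvg d ρ z (fun w => G w ^ q) ≤ (ENNReal.ofReal (ρ ^ (-β)) * MorreyNorm d q β univ G) ^ q := by
  have h1 : ENNReal.ofReal (ρ ^ β) * (pAvg d ρ z fun w => G w ^ q) ^ (1 / q) ≤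
      MorreyNorm d q β univ G := by
    unfold MorreyNorm
    refine le_iSup_of_le ρ <| le_iSup_of_le hρ <| le_iSup_of_le z <| le_iSup_of_le (mem_univ _) ?_
    simp
  have h2 : (pAvg d ρ z fun w => G w ^ q) ^ (1 / q) ≤
      ENNReal.ofReal (ρ ^ (-β)) * MorreyNorm d q β univ G := by
    calc _ = ENNReal.ofReal (ρ ^ (-β)) * (ENNReal.ofReal (ρ ^ β) *
          (pAvg d ρ z fun w => G w ^ q) ^ (1 / q)) := by
          rw [← mul_assoc, ← ENNReal.ofReal_mul (by positivity), ← Real.rpow_add hρ]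
          simp
      _ ≤ _ := by gcongr
  calc _ = ((pAvg d ρ z fun w => G w ^ q) ^ (1 / q)) ^ q := by
        rw [← ENNReal.rpow_mul, one_div_mul_cancel (by linarith), ENNReal.rpow_one]
    _ ≤ _ := by gcongr

lemma qAvg_rpow_le {d : ℕ} {q β : ℝ} (hq : 1 < q) (hβ : 1 < β) (G : Pt d → ℝ≥0∞) {r : ℝ}
    (hr : 0 < r) (z : Pt d) :
    qAvg d r z (fun w => G w ^ q) ≤
      2 ^ (d + 1) * (ENNReal.ofReal (r ^ (-β)) * MorreyNorm d q β univ G) ^ q := by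
  set z' : Pt d := (z.1 - r ^ 2, z.2)
  have hsub : symQ d r z ⊆ pCyl d (2 * r) z' := by
    rintro w ⟨h1, h2⟩
    rw [abs_lt] at h2
    refine ⟨?_, ?_, ?_⟩
    · change dist z.2 w.2 < 2 * r
      linarith
    · change z.1 - r ^ 2 ≤ w.1
      linarith
    · change w.1 < z.1 - r ^ 2 + (2 * r) ^ 2
      nlinarith
  have hvol : volume (pCyl d (2 * r) z') = 2 ^ (d + 1) * volume (symQ d r z) := by
    rw [volume_pCyl d (by positivity), volume_symQ d hr, ← mul_assoc]
    congr 1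
    rw [show (2:ℝ≥0∞) = ENNReal.ofReal 2 by simp, ← ENNReal.ofReal_pow (by norm_num),
      ← ENNReal.ofReal_mul (by positivity)]
    congr 1; ring
  have hinv : (volume (symQ d r z))⁻¹ = 2 ^ (d + 1) * (volume (pCyl d (2 * r) z'))⁻¹ := by
    rw [hvol, ENNReal.mul_inv (by simp) (by simp), ← mul_assoc,
      ENNReal.mul_inv_cancel (by simp) (by simp), one_mul]
  calc _ ≤ (volume (symQ d r z))⁻¹ * ∫⁻ w in pCyl d (2 * r) z', G w ^ q := by
        unfold qAvg
        gcongr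
    _ = 2 ^ (d + 1) * pAvg d (2 * r) z' (fun w => G w ^ q) := by
        rw [hinv, pAvg, mul_assoc]
    _ ≤ 2 ^ (d + 1) * (ENNReal.ofReal ((2 * r) ^ (-β)) * MorreyNorm d q β univ G) ^ q := by
        gcongr
        exact pAvg_le_morrey hq G (by positivity) z'
    _ ≤ _ := by
        gcongr 2 ^ (d + 1) * (ENNReal.ofReal ?_ * _) ^ q
        apply Real.rpow_le_rpow_of_nonpos hr (by linarith) (by linarith)

lemma qAvg_le_rpow {d : ℕ} {q : ℝ} (hq : 1 < q) (G : Pt d → ℝ≥0∞) (hG : Measurable G) {r : ℝ}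
    (hr : 0 < r) (z : Pt d) :
    qAvg d r z G ≤ (qAvg d r z (fun w => G w ^ q)) ^ (1 / q) := by
  set μ := (volume (symQ d r z))⁻¹ • (volume.restrict (symQ d r z)) with hμ
  have h : ∀ F : Pt d → ℝ≥0∞, qAvg d r z F = ∫⁻ w, F w ∂μ := by
    intro F
    rw [hμ, lintegral_smul_measure]; rfl
  have h1 : μ univ = 1 := by
    rw [hμ]; simp
    exact ENNReal.inv_mul_cancel (volume_symQ_ne_zero d hr z) (volume_symQ_ne_top d hr z)
  have := ENNReal.lintegral_mul_le_Lp_mul_Lq μ (Real.HolderConjugate.conjExponent hq)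
    hG.aemeasurable (measurable_const (a := (1 : ℝ≥0∞))).aemeasurable
  rw [h, h]
  simpa [h1] using this

lemma qAvg_le {d : ℕ} {q β : ℝ} (hq : 1 < q) (hβ : 1 < β) (G : Pt d → ℝ≥0∞) (hG : Measurable G)
    {r : ℝ} (hr : 0 < r) (z : Pt d) :
    qAvg d r z G ≤ 2 ^ (d + 1) * (ENNReal.ofReal (r ^ (-β)) * MorreyNorm d q β univ G) := by
  have hq0 : 0 < q := by linarith
  calc _ ≤ _ := qAvg_le_rpow hq G hG hr z
    _ ≤ (2 ^ (d + 1) * (ENNReal.ofReal (r ^ (-β)) * MorreyNorm d q β univ G) ^ q) ^ (1 / q) := by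
        gcongr
        exact qAvg_rpow_le hq hβ G hr z
    _ = ((2:ℝ≥0∞) ^ (d + 1)) ^ (1 / q) * (ENNReal.ofReal (r ^ (-β)) * MorreyNorm d q β univ G) := by
        rw [ENNReal.mul_rpow_of_nonneg _ _ (by positivity), ← ENNReal.rpow_mul,
          mul_one_div_cancel hq0.ne', ENNReal.rpow_one]
    _ ≤ _ := by
        gcongr
        calc ((2:ℝ≥0∞) ^ (d + 1)) ^ (1 / q) ≤ ((2:ℝ≥0∞) ^ (d + 1)) ^ (1 : ℝ) := by
              apply ENNReal.rpow_le_rpow_of_exponent_le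
              · exact one_le_pow₀ (by norm_num)
              · rw [div_le_one hq0]; exact hq.le
          _ = _ := ENNReal.rpow_one _

lemma maxQ_morrey (d : ℕ) {q β : ℝ} (hq : 1 < q) (hβ : 1 < β) : ∃ C : ℝ≥0∞, C ≠ ⊤ ∧
    ∀ (g : Pt d → ℝ) (B : ℝ), Measurable g → (∀ z, 0 ≤ g z) → (∀ z, g z ≤ B) →
      ∀ (ρ : ℝ) (z0 : Pt d), 0 < ρ →
      pAvg d ρ z0 (fun z => maxQ d (fun z => ENNReal.ofReal (g z)) z ^ q) ≤
        C * (ENNReal.ofReal (ρ ^ (-β)) *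
          MorreyNorm d q β univ (fun z => ENNReal.ofReal (g z))) ^ q := by
  obtain ⟨CM, hCM, hst⟩ := strong_type d hq
  refine ⟨CM * (2 * 3 ^ (d + 2)) * 2 ^ (d + 1) + (2 ^ (d + 1)) ^ q, ?_, ?_⟩
  · have : ((2:ℝ≥0∞) ^ (d + 1)) ^ q ≠ ⊤ := ENNReal.rpow_ne_top_of_nonneg (by linarith) (by finiteness)
    finiteness
  intro g B hg hg0 hgB ρ z0 hρ
  set G : Pt d → ℝ≥0∞ := fun z => ENNReal.ofReal (g z) with hG
  have hGm : Measurable G := hg.ennreal_ofReal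
  set K := MorreyNorm d q β univ G with hK
  set Q := symQ d (3 * ρ) z0 with hQ
  have hQm : MeasurableSet Q := (isOpen_symQ d _ _).measurableSet
  set g1 := indicator Q g with hg1
  set G1 : Pt d → ℝ≥0∞ := fun z => ENNReal.ofReal (g1 z) with hG1
  have hG1e : ∀ z ∈ Q, G1 z = G z := by
    intro z hz; simp only [hG1, hg1, hG, indicator_of_mem hz]
  have hB : 0 ≤ B := (hg0 z0).trans (hgB z0)
  have hpt : ∀ z ∈ pCyl d ρ z0, maxQ d G z ^ q ≤
      maxQ d G1 z ^ q + (2 ^ (d + 1) * (ENNReal.ofReal (ρ ^ (-β)) * K)) ^ q := by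
    rintro z ⟨hz1, hz2, hz3⟩
    have : maxQ d G z ≤ max (maxQ d G1 z) (2 ^ (d + 1) * (ENNReal.ofReal (ρ ^ (-β)) * K)) := by
      apply maxQ_le
      intro r w hr hzw
      rcases lt_or_ge r ρ with h | h
      · apply le_max_of_le_left
        have hsub : symQ d r w ⊆ Q := by
          rintro y ⟨hy1, hy2⟩
          obtain ⟨h1, h2⟩ := hzw
          refine ⟨?_, ?_⟩
          · have := dist_triangle4 z0.2 z.2 w.2 y.2
            rw [dist_comm z.2] at this
            linarith
          · rw [abs_lt] at *
            constructor <;> nlinarith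
        have : qAvg d r w G = qAvg d r w G1 := by
          unfold qAvg
          congr 1
          exact setLIntegral_congr_fun (isOpen_symQ d _ _).measurableSet
            fun y hy => (hG1e y (hsub hy)).symm
        rw [this]
        exact qAvg_le_maxQ hr hzw
      · apply le_max_of_le_right
        refine (qAvg_le hq hβ G hGm hr w).trans ?_
        gcongr 2 ^ (d + 1) * (ENNReal.ofReal ?_ * _)
        exact Real.rpow_le_rpow_of_nonpos hρ h (by linarith)
    calc _ ≤ (max (maxQ d G1 z) (2 ^ (d + 1) * (ENNReal.ofReal (ρ ^ (-β)) * K))) ^ q := by gcongr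
      _ ≤ _ := by
        rcases max_choice (maxQ d G1 z) (2 ^ (d + 1) * (ENNReal.ofReal (ρ ^ (-β)) * K)) with h | h
        · rw [h]; exact le_self_add
        · rw [h]; exact le_add_self
  have hg1m : Measurable g1 := hg.indicator hQm
  have h1 := hst g1 B hg1m (fun z => indicator_nonneg (fun z _ => hg0 z) z)
    (fun z => indicator_le' (fun z _ => hgB z) (fun _ _ => hB) z)
  have h2 : ∫⁻ z, G1 z ^ q = ∫⁻ z in Q, G z ^ q := by
    rw [← lintegral_indicator hQm]
    congr 1; ext z
    by_cases hz : z ∈ Q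
    · rw [indicator_of_mem hz, hG1e z hz]
    · rw [indicator_of_notMem hz]
      simp only [hG1, hg1, indicator_of_notMem hz]
      simp [show 0 < q by linarith]
  set V := volume (pCyl d ρ z0) with hV
  have hV0 := volume_pCyl_ne_zero d hρ z0
  have hVt := volume_pCyl_ne_top d hρ z0
  have hvQ : volume Q = 2 * 3 ^ (d + 2) * V := by
    rw [hQ, hV, volume_pCyl d hρ, volume_symQ d (by positivity), ← mul_assoc]
    congr 1
    rw [show (2:ℝ≥0∞) = ENNReal.ofReal 2 by simp, show (3:ℝ≥0∞) = ENNReal.ofReal 3 by simp,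
      ← ENNReal.ofReal_pow (by norm_num),
      ← ENNReal.ofReal_mul (by positivity), ← ENNReal.ofReal_mul (by positivity)]
    congr 1; ring
  have h3 : ∫⁻ z in Q, G z ^ q ≤
      2 * 3 ^ (d + 2) * V * (2 ^ (d + 1) * (ENNReal.ofReal (ρ ^ (-β)) * K) ^ q) := by
    have h4 := qAvg_rpow_le hq hβ G (show 0 < 3 * ρ by positivity) z0
    calc _ = volume Q * qAvg d (3 * ρ) z0 (fun w => G w ^ q) := by
          rw [qAvg, ← mul_assoc, ENNReal.mul_inv_cancel (volume_symQ_ne_zero d (by positivity) z0)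
            (volume_symQ_ne_top d (by positivity) z0), one_mul]
      _ ≤ volume Q * (2 ^ (d + 1) * (ENNReal.ofReal ((3 * ρ) ^ (-β)) * K) ^ q) := by gcongr
      _ ≤ volume Q * (2 ^ (d + 1) * (ENNReal.ofReal (ρ ^ (-β)) * K) ^ q) := by
          gcongr volume Q * (2 ^ (d + 1) * (ENNReal.ofReal ?_ * _) ^ q)
          exact Real.rpow_le_rpow_of_nonpos hρ (by linarith) (by linarith)
      _ = _ := by rw [hvQ]
  unfold pAvg
  calc _ ≤ V⁻¹ * ∫⁻ z in pCyl d ρ z0, (maxQ d G1 z ^ q +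
          (2 ^ (d + 1) * (ENNReal.ofReal (ρ ^ (-β)) * K)) ^ q) := by
        gcongr V⁻¹ * ?_
        exact setLIntegral_mono' (measurableSet_pCyl d ρ z0) hpt
    _ = V⁻¹ * ((∫⁻ z in pCyl d ρ z0, maxQ d G1 z ^ q) +
          (2 ^ (d + 1) * (ENNReal.ofReal (ρ ^ (-β)) * K)) ^ q * V) := by
        rw [lintegral_add_right _ measurable_const, setLIntegral_const]
    _ ≤ V⁻¹ * (CM * (2 * 3 ^ (d + 2) * V * (2 ^ (d + 1) * (ENNReal.ofReal (ρ ^ (-β)) * K) ^ q)) +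
          (2 ^ (d + 1) * (ENNReal.ofReal (ρ ^ (-β)) * K)) ^ q * V) := by
        gcongr
        calc _ ≤ ∫⁻ z, maxQ d G1 z ^ q := setLIntegral_le_lintegral _ _
          _ ≤ _ := h1
          _ ≤ _ := by
            gcongr
            exact h2.le.trans h3
    _ = (V⁻¹ * V) * (CM * (2 * 3 ^ (d + 2) * (2 ^ (d + 1) * (ENNReal.ofReal (ρ ^ (-β)) * K) ^ q)) +
          (2 ^ (d + 1) * (ENNReal.ofReal (ρ ^ (-β)) * K)) ^ q) := by ring
    _ = _ := by
        rw [ENNReal.inv_mul_cancel hV0 hVt, one_mul,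
          ENNReal.mul_rpow_of_nonneg (2 ^ (d + 1)) _ (by linarith : 0 ≤ q)]
        ring

lemma hedberg_int {β : ℝ} (hβ : 1 < β) (A : ℝ → ℝ≥0∞) (M K : ℝ≥0∞) (hM : M ≠ ⊤)
    (h1 : ∀ τ, 0 < τ → A τ ≤ M) (h2 : ∀ τ, 0 < τ → A τ ≤ ENNReal.ofReal (τ ^ (-β)) * K) :
    ∫⁻ τ in Ioi (0:ℝ), A τ ≤ ENNReal.ofReal (1 + 1 / (β - 1)) * (K ^ (1 / β) * M ^ (1 - 1 / β)) := by
  have hβ1 : 0 < β - 1 := by linarith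
  have hβ0 : 0 < β := by linarith
  have hb1 : 0 < 1 - 1 / β := by
    rw [sub_pos, div_lt_one hβ0]; exact hβ
  rcases eq_or_ne M 0 with hM0 | hM0
  · have : ∫⁻ τ in Ioi (0:ℝ), A τ ≤ ∫⁻ τ in Ioi (0:ℝ), 0 :=
      setLIntegral_mono' measurableSet_Ioi fun τ hτ => (h1 τ hτ).trans hM0.le
    refine this.trans ?_
    simp
  rcases eq_or_ne K 0 with hK0 | hK0
  · have : ∫⁻ τ in Ioi (0:ℝ), A τ ≤ ∫⁻ τ in Ioi (0:ℝ), 0 :=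
      setLIntegral_mono' measurableSet_Ioi fun τ hτ => (h2 τ hτ).trans (by simp [hK0])
    refine this.trans ?_
    simp
  rcases eq_or_ne K ⊤ with hKt | hKt
  · have hMp : M ^ (1 - 1 / β) ≠ 0 := by
      simp [ENNReal.rpow_eq_zero_iff, hM0, hM]
    rw [hKt, ENNReal.top_rpow_of_pos (by positivity), ENNReal.top_mul hMp, ENNReal.mul_top]
    · exact le_top
    · simp; positivity
  lift M to NNReal using hM
  lift K to NNReal using hKt
  have hM0' : 0 < (M:ℝ) := by
    have : M ≠ 0 := by simpa using hM0
    positivity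
  have hK0' : 0 < (K:ℝ) := by
    have : K ≠ 0 := by simpa using hK0
    positivity
  set R : ℝ := ((K:ℝ) / M) ^ (1 / β) with hR
  have hR0 : 0 < R := by positivity
  have hRb : R ^ β = K / M := by
    rw [hR, ← Real.rpow_mul (by positivity), one_div_mul_cancel hβ0.ne', Real.rpow_one]
  have hRM : R * M = (K:ℝ) ^ (1 / β) * (M:ℝ) ^ (1 - 1 / β) := by
    rw [hR, Real.div_rpow hK0'.le hM0'.le, Real.rpow_sub hM0', Real.rpow_one]
    field_simp
  have hRK : R ^ (1 - β) * K = R * M := by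
    rw [Real.rpow_sub hR0, hRb, Real.rpow_one]
    field_simp
  have eM : (M : ℝ≥0∞) = ENNReal.ofReal M := by simp
  have eK : (K : ℝ≥0∞) = ENNReal.ofReal K := by simp
  have i1 : ∫⁻ τ in Ioc 0 R, A τ ≤ ENNReal.ofReal (R * M) := by
    calc _ ≤ ∫⁻ τ in Ioc 0 R, (M : ℝ≥0∞) :=
          setLIntegral_mono' measurableSet_Ioc fun τ hτ => h1 τ hτ.1
      _ = _ := by
          rw [setLIntegral_const, Real.volume_Ioc, eM, ← ENNReal.ofReal_mul (by positivity)]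
          congr 1; ring
  have i2 : ∫⁻ τ in Ioi R, A τ ≤ ENNReal.ofReal (R * M * (1 / (β - 1))) := by
    calc _ ≤ ∫⁻ τ in Ioi R, ENNReal.ofReal (τ ^ (-β)) * K :=
          setLIntegral_mono' measurableSet_Ioi fun τ hτ => h2 τ (hR0.trans hτ)
      _ = (∫⁻ τ in Ioi R, ENNReal.ofReal (τ ^ (-β))) * K := by
          rw [lintegral_mul_const' _ _ (by simp)]
      _ = ENNReal.ofReal (∫ τ in Ioi R, τ ^ (-β)) * K := by
          rw [ofReal_integral_eq_lintegral_ofReal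
            (integrableOn_Ioi_rpow_of_lt (by linarith) hR0)]
          filter_upwards [ae_restrict_mem measurableSet_Ioi] with τ hτ
          have : 0 < τ := hR0.trans hτ
          positivity
      _ = _ := by
          rw [integral_Ioi_rpow_of_lt (by linarith) hR0, eK, ← ENNReal.ofReal_mul
            (by
              have : -β + 1 = -(β - 1) := by ring
              rw [this, neg_div_neg_eq]; positivity), ← hRK]
          congr 1
          rw [show -β + 1 = 1 - β by ring]
          have : 1 - β ≠ 0 := by linarith
          field_simp
          rw [show (1 - β) = -(β - 1) by ring]
  rw [← Ioc_union_Ioi_eq_Ioi hR0.le]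
  calc _ ≤ _ := lintegral_union_le _ _ _
    _ ≤ ENNReal.ofReal (R * M) + ENNReal.ofReal (R * M * (1 / (β - 1))) := add_le_add i1 i2
    _ = _ := by
      rw [eM, eK, ENNReal.ofReal_rpow_of_pos hM0', ENNReal.ofReal_rpow_of_pos hK0',
        ← ENNReal.ofReal_mul (by positivity), ← hRM, ← ENNReal.ofReal_add (by positivity)
        (by positivity), ← ENNReal.ofReal_mul (by positivity)]
      congr 1; ring

lemma gauss_decay (d : ℕ) {a : ℝ} (ha : 0 ≤ a) :
    a * Real.exp (-a ^ 2 / 4) * (max 1 a) ^ (d + 1) ≤ 4 ^ (d + 2) * (d + 2).factorial := by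
  have hfac : (1:ℝ) ≤ (d + 2).factorial := by exact_mod_cast Nat.one_le_iff_ne_zero.2 (Nat.factorial_ne_zero _)
  have h4 : (1:ℝ) ≤ 4 ^ (d + 2) := one_le_pow₀ (by norm_num)
  rcases le_total a 1 with h | h
  · rw [max_eq_left h, one_pow, mul_one]
    have : Real.exp (-a ^ 2 / 4) ≤ 1 := Real.exp_le_one_iff.2 (by nlinarith [sq_nonneg a])
    have h0 := Real.exp_pos (-a ^ 2 / 4)
    nlinarith
  · rw [max_eq_right h]
    have h1 := Real.pow_div_factorial_le_exp (a ^ 2 / 4) (by positivity) (d + 2)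
    have h2 : a ^ (d + 2) ≤ (a ^ 2) ^ (d + 2) := by
      gcongr; nlinarith
    have h3 : (a ^ 2) ^ (d + 2) ≤ 4 ^ (d + 2) * (d + 2).factorial * Real.exp (a ^ 2 / 4) := by
      rw [div_pow, div_div, div_le_iff₀ (by positivity)] at h1
      linarith
    have h5 : -a ^ 2 / 4 = -(a ^ 2 / 4) := by ring
    rw [h5, Real.exp_neg]
    calc _ = a ^ (d + 2) / Real.exp (a ^ 2 / 4) := by field_simp; ring
      _ ≤ _ := by rw [div_le_iff₀ (Real.exp_pos _)]; linarith

/-- The kernel constant. -/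
def c0 (d : ℕ) : ℝ := 2 ^ (d + 2) * (4 ^ (d + 2) * (d + 2).factorial)

lemma kernel_bound (d : ℕ) {σ : ℝ} (hσ : 0 < σ) {y : ℝ} (hy : 0 ≤ y) :
    ENNReal.ofReal ((σ ^ d)⁻¹ * ((y / σ) * Real.exp (-(y / σ) ^ 2 / 4))) ≤
      ∫⁻ τ in Ioi (0:ℝ), ENNReal.ofReal (c0 d) * ({τ : ℝ | σ < τ ∧ y < τ}.indicator
        (fun τ => ENNReal.ofReal (σ * (τ ^ (d + 2))⁻¹)) τ) := by
  set m := max σ y with hm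
  have hm0 : 0 < m := lt_max_of_lt_left hσ
  have hmm : m = σ * max 1 (y / σ) := by
    rw [mul_max_of_nonneg _ _ hσ.le, mul_one, mul_div_cancel₀ _ hσ.ne']
  have hc : 0 < c0 d := by unfold c0; positivity
  have step : ∀ τ ∈ Ioo m (2 * m), ENNReal.ofReal (c0 d * (σ * ((2 * m) ^ (d + 2))⁻¹)) ≤
      ENNReal.ofReal (c0 d) * ({τ : ℝ | σ < τ ∧ y < τ}.indicator
        (fun τ => ENNReal.ofReal (σ * (τ ^ (d + 2))⁻¹)) τ) := by
    intro τ hτ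
    have : τ ∈ {τ : ℝ | σ < τ ∧ y < τ} :=
      ⟨(le_max_left _ _).trans_lt hτ.1, (le_max_right _ _).trans_lt hτ.1⟩
    have hτ0 : 0 < τ := hm0.trans hτ.1
    rw [indicator_of_mem this, ← ENNReal.ofReal_mul hc.le]
    apply ENNReal.ofReal_le_ofReal
    have := hτ.2.le
    gcongr
  calc _ ≤ ENNReal.ofReal (c0 d * (σ * ((2 * m) ^ (d + 2))⁻¹) * m) := by
        apply ENNReal.ofReal_le_ofReal
        have := gauss_decay d (div_nonneg hy hσ.le)
        set e := max 1 (y / σ) with he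
        have he0 : 0 < e := lt_max_of_lt_left one_pos
        set X := y / σ * Real.exp (-(y / σ) ^ 2 / 4) with hX
        rw [hmm, c0]
        have : X ≤ 4 ^ (d + 2) * (d + 2).factorial / e ^ (d + 1) := by
          rw [le_div_iff₀ (by positivity)]; exact this
        calc _ ≤ (σ ^ d)⁻¹ * (4 ^ (d + 2) * (d + 2).factorial / e ^ (d + 1)) := by gcongr
          _ = _ := by
            rw [mul_pow, mul_pow, pow_add σ d 2, show e ^ (d + 2) = e ^ (d + 1) * e by ring]
            field_simp
    _ = ∫⁻ τ in Ioo m (2 * m), ENNReal.ofReal (c0 d * (σ * ((2 * m) ^ (d + 2))⁻¹)) := by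
        rw [setLIntegral_const, Real.volume_Ioo, ← ENNReal.ofReal_mul (by positivity)]
        congr 2; ring
    _ ≤ ∫⁻ τ in Ioo m (2 * m), ENNReal.ofReal (c0 d) * ({τ : ℝ | σ < τ ∧ y < τ}.indicator
        (fun τ => ENNReal.ofReal (σ * (τ ^ (d + 2))⁻¹)) τ) := setLIntegral_mono' measurableSet_Ioo step
    _ ≤ _ := lintegral_mono_set fun τ hτ => hm0.trans hτ.1

/-- The (unnormalized) potential obtained from the Gaussian representation. -/
def gPot (d : ℕ) (G : Pt d → ℝ≥0∞) (z : Pt d) : ℝ≥0∞ :=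
  ∫⁻ σ in Ioi (0:ℝ), ∫⁻ w : Ed d, ENNReal.ofReal (‖w‖ * Real.exp (-‖w‖ ^ 2 / 4)) *
    G (z.1 + σ ^ 2, z.2 + σ • w)

lemma scale_int (d : ℕ) (G : Pt d → ℝ≥0∞) (hG : Measurable G) (z : Pt d) {σ : ℝ} (hσ : 0 < σ) :
    ∫⁻ w : Ed d, ENNReal.ofReal (‖w‖ * Real.exp (-‖w‖ ^ 2 / 4)) * G (z.1 + σ ^ 2, z.2 + σ • w) =
    ∫⁻ y : Ed d, ENNReal.ofReal ((σ ^ d)⁻¹ * ((‖y‖ / σ) * Real.exp (-(‖y‖ / σ) ^ 2 / 4))) *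
      G (z.1 + σ ^ 2, z.2 + y) := by
  have h := Measure.map_addHaar_smul (volume : Measure (Ed d)) hσ.ne'
  set F : Ed d → ℝ≥0∞ := fun y => ENNReal.ofReal ((‖y‖ / σ) * Real.exp (-(‖y‖ / σ) ^ 2 / 4)) *
      G (z.1 + σ ^ 2, z.2 + y) with hF
  have hFm : Measurable F := by
    apply Measurable.mul
    · fun_prop
    · exact hG.comp (by fun_prop)
  have h2 : ∫⁻ w, F (σ • w) = ENNReal.ofReal ((σ ^ d)⁻¹) * ∫⁻ y, F y := by
    rw [← lintegral_map (f := F) (g := fun w => σ • w) hFm (measurable_const_smul σ), h,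
      lintegral_smul_measure]
    simp [abs_of_pos hσ]
  calc _ = ∫⁻ w, F (σ • w) := by
        congr 1; ext w
        simp only [hF, norm_smul, Real.norm_eq_abs, abs_of_pos hσ]
        rw [mul_div_cancel_left₀ _ hσ.ne']
    _ = _ := by
        rw [h2, ← lintegral_const_mul _ hFm]
        congr 1; ext y
        rw [hF, ← mul_assoc, ← ENNReal.ofReal_mul (by positivity)]

lemma inner_tau (d : ℕ) (G : Pt d → ℝ≥0∞) (hG : Measurable G) (z : Pt d) {τ : ℝ} (hτ : 0 < τ) :
    ∫⁻ σ in Ioi (0:ℝ), ∫⁻ y : Ed d, ({p : ℝ × Ed d | p.1 < τ ∧ ‖p.2‖ < τ}.indicator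
        (fun p => ENNReal.ofReal (p.1 * (τ ^ (d + 2))⁻¹) * G (z.1 + p.1 ^ 2, z.2 + p.2)) (σ, y))
      ≤ 2 * kap d * qAvg d τ z G := by
  set H : ℝ → ℝ≥0∞ := fun s => ∫⁻ y in Metric.ball z.2 τ, G (s, y) with hH
  have hHm : Measurable H := by
    apply Measurable.lintegral_prod_right' (f := fun p : ℝ × Ed d => G p) hG
  have e1 : ∀ σ : ℝ, ∫⁻ y : Ed d, ({p : ℝ × Ed d | p.1 < τ ∧ ‖p.2‖ < τ}.indicator
        (fun p => ENNReal.ofReal (p.1 * (τ ^ (d + 2))⁻¹) * G (z.1 + p.1 ^ 2, z.2 + p.2)) (σ, y))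
      = (Iio τ).indicator (fun σ => ENNReal.ofReal (σ * (τ ^ (d + 2))⁻¹) * H (z.1 + σ ^ 2)) σ := by
    intro σ
    by_cases hs : σ < τ
    · rw [indicator_of_mem (show σ ∈ Iio τ from hs), hH]
      simp only
      rw [← lintegral_indicator measurableSet_ball, ← lintegral_const_mul' _ _ ENNReal.ofReal_ne_top,
        ← lintegral_add_left_eq_self (fun y => ENNReal.ofReal (σ * (τ ^ (d + 2))⁻¹) *
          (Metric.ball z.2 τ).indicator (fun y => G (z.1 + σ ^ 2, y)) y) z.2]
      congr 1; ext y
      by_cases hy : ‖y‖ < τ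
      · rw [indicator_of_mem (show (σ, y) ∈ {p : ℝ × Ed d | p.1 < τ ∧ ‖p.2‖ < τ} from ⟨hs, hy⟩),
          indicator_of_mem (show z.2 + y ∈ Metric.ball z.2 τ by simpa using hy)]
      · rw [indicator_of_notMem (show (σ, y) ∉ {p : ℝ × Ed d | p.1 < τ ∧ ‖p.2‖ < τ} from fun h => hy h.2),
          indicator_of_notMem (show z.2 + y ∉ Metric.ball z.2 τ by simpa using hy), mul_zero]
    · rw [indicator_of_notMem (show σ ∉ Iio τ from hs)]
      have : ∀ y : Ed d, (σ, y) ∉ {p : ℝ × Ed d | p.1 < τ ∧ ‖p.2‖ < τ} := fun y h => hs h.1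
      simp only [indicator_of_notMem (this _), lintegral_zero]
  simp only [e1]
  rw [lintegral_indicator measurableSet_Iio, Measure.restrict_restrict measurableSet_Iio,
    inter_comm, Ioi_inter_Iio]
  have cv := lintegral_image_eq_lintegral_abs_deriv_mul (s := Ioo 0 τ) (f := fun σ => z.1 + σ ^ 2)
    (f' := fun σ => 2 * σ) measurableSet_Ioo (fun x _ => by
      have := ((hasDerivAt_pow 2 x).const_add z.1).hasDerivWithinAt (s := Ioo 0 τ)
      simpa using this) (fun a ha b hb hab => by
      have h0 : a ^ 2 = b ^ 2 := by simpa using hab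
      exact (pow_left_inj₀ ha.1.le hb.1.le two_ne_zero).1 h0) H
  have himg : (fun σ => z.1 + σ ^ 2) '' Ioo 0 τ ⊆ Ioo (z.1 - τ ^ 2) (z.1 + τ ^ 2) := by
    rintro _ ⟨σ, hσ, rfl⟩
    constructor
    · simp only; nlinarith [sq_nonneg σ, sq_pos_of_pos hτ]
    · simp only; nlinarith [hσ.1, hσ.2]
  have hQ : ∫⁻ s in Ioo (z.1 - τ ^ 2) (z.1 + τ ^ 2), H s = ∫⁻ w in symQ d τ z, G w := by
    rw [symQ_eq, Measure.volume_eq_prod, ← Measure.prod_restrict, lintegral_prod _ hG.aemeasurable]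
  calc ∫⁻ σ in Ioo 0 τ, ENNReal.ofReal (σ * (τ ^ (d + 2))⁻¹) * H (z.1 + σ ^ 2)
      ≤ ∫⁻ σ in Ioo 0 τ, ENNReal.ofReal ((τ ^ (d + 2))⁻¹) * (ENNReal.ofReal |2 * σ| * H (z.1 + σ ^ 2)) := by
        refine setLIntegral_mono' measurableSet_Ioo fun σ hσ => ?_
        rw [← mul_assoc, ← ENNReal.ofReal_mul (by positivity)]
        gcongr ENNReal.ofReal ?_ * _
        rw [mul_comm]
        gcongr
        rw [abs_of_pos (by linarith [hσ.1])]
        linarith [hσ.1]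
    _ = ENNReal.ofReal ((τ ^ (d + 2))⁻¹) * ∫⁻ s in (fun σ => z.1 + σ ^ 2) '' Ioo 0 τ, H s := by
        rw [lintegral_const_mul' _ _ ENNReal.ofReal_ne_top, cv]
    _ ≤ ENNReal.ofReal ((τ ^ (d + 2))⁻¹) * ∫⁻ w in symQ d τ z, G w := by
        gcongr
        rw [← hQ]
        exact lintegral_mono_set himg
    _ = _ := by
        have hV := volume_symQ d hτ z
        have : ENNReal.ofReal ((τ ^ (d + 2))⁻¹) = 2 * kap d * (volume (symQ d τ z))⁻¹ := by
          rw [hV, ENNReal.mul_inv (Or.inr (kap_ne_top d)) (Or.inr (kap_ne_zero d)),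
            ENNReal.ofReal_inv_of_pos (by positivity), ENNReal.ofReal_mul (by norm_num),
            ENNReal.mul_inv (by simp) (by simp)]
          calc _ = (2 * 2⁻¹) * (ENNReal.ofReal (τ ^ (d + 2)))⁻¹ * (kap d * (kap d)⁻¹) := by
                rw [ENNReal.mul_inv_cancel (by simp) (by simp),
                  ENNReal.mul_inv_cancel (kap_ne_zero d) (kap_ne_top d), one_mul, mul_one]
            _ = _ := by simp only [ENNReal.ofReal_ofNat]; ring
        rw [this, qAvg, mul_assoc]

lemma gPot_le (d : ℕ) (G : Pt d → ℝ≥0∞) (hG : Measurable G) (z : Pt d) :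
    gPot d G z ≤ ENNReal.ofReal (c0 d) * (2 * kap d) * ∫⁻ τ in Ioi (0:ℝ), qAvg d τ z G := by
  set Φ : ℝ → ℝ → Ed d → ℝ≥0∞ := fun τ σ y => {p : ℝ × Ed d | p.1 < τ ∧ ‖p.2‖ < τ}.indicator
        (fun p => ENNReal.ofReal (p.1 * (τ ^ (d + 2))⁻¹) * G (z.1 + p.1 ^ 2, z.2 + p.2)) (σ, y) with hΦ
  have hΦm : Measurable (fun x : ℝ × ℝ × Ed d => Φ x.1 x.2.1 x.2.2) := by
    have : (fun x : ℝ × ℝ × Ed d => Φ x.1 x.2.1 x.2.2) =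
      {x : ℝ × ℝ × Ed d | x.2.1 < x.1 ∧ ‖x.2.2‖ < x.1}.indicator (fun x =>
        ENNReal.ofReal (x.2.1 * (x.1 ^ (d + 2))⁻¹) * G (z.1 + x.2.1 ^ 2, z.2 + x.2.2)) := by
      ext x; simp only [hΦ, indicator]; rfl
    rw [this]
    apply Measurable.indicator
    · apply Measurable.mul
      · fun_prop
      · exact hG.comp (by fun_prop)
    · apply MeasurableSet.inter
      · exact measurableSet_lt (f := fun x : ℝ × ℝ × Ed d => x.2.1) (g := fun x => x.1)
          (by fun_prop) (by fun_prop)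
      · exact measurableSet_lt (f := fun x : ℝ × ℝ × Ed d => ‖x.2.2‖) (g := fun x => x.1)
          (by fun_prop) (by fun_prop)
  calc gPot d G z = ∫⁻ σ in Ioi (0:ℝ), ∫⁻ y : Ed d,
        ENNReal.ofReal ((σ ^ d)⁻¹ * ((‖y‖ / σ) * Real.exp (-(‖y‖ / σ) ^ 2 / 4))) *
          G (z.1 + σ ^ 2, z.2 + y) := 
        setLIntegral_congr_fun measurableSet_Ioi fun σ hσ => scale_int d G hG z hσ
    _ ≤ ∫⁻ σ in Ioi (0:ℝ), ∫⁻ y : Ed d, ∫⁻ τ in Ioi (0:ℝ), ENNReal.ofReal (c0 d) * Φ τ σ y := by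
        refine setLIntegral_mono' measurableSet_Ioi fun σ hσ => lintegral_mono fun y => ?_
        refine (mul_le_mul_left (kernel_bound d hσ (norm_nonneg y)) _).trans ?_
        rw [← lintegral_mul_const]
        · refine lintegral_mono fun τ => ?_
          rw [mul_assoc]
          gcongr
          simp only [hΦ, indicator]
          by_cases h : σ < τ ∧ ‖y‖ < τ
          · simp [h]
          · simp [h]
        · apply Measurable.const_mul
          apply Measurable.indicator (by fun_prop)
          exact measurableSet_Ioi.inter measurableSet_Ioi
    _ = ENNReal.ofReal (c0 d) * ∫⁻ σ in Ioi (0:ℝ), ∫⁻ y : Ed d, ∫⁻ τ in Ioi (0:ℝ), Φ τ σ y := by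
        simp only [lintegral_const_mul' _ _ (ENNReal.ofReal_ne_top (r := c0 d))]
    _ = ENNReal.ofReal (c0 d) * ∫⁻ σ in Ioi (0:ℝ), ∫⁻ τ in Ioi (0:ℝ), ∫⁻ y : Ed d, Φ τ σ y := by
        congr 2; ext σ
        rw [lintegral_lintegral_swap]
        apply Measurable.aemeasurable
        exact hΦm.comp (f := fun p : Ed d × ℝ => (p.2, σ, p.1)) (by fun_prop)
    _ = ENNReal.ofReal (c0 d) * ∫⁻ τ in Ioi (0:ℝ), ∫⁻ σ in Ioi (0:ℝ), ∫⁻ y : Ed d, Φ τ σ y := by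
        congr 1
        rw [lintegral_lintegral_swap]
        apply Measurable.aemeasurable
        apply Measurable.lintegral_prod_right' (f := fun p : (ℝ × ℝ) × Ed d => Φ p.1.2 p.1.1 p.2)
        exact hΦm.comp (f := fun p : (ℝ × ℝ) × Ed d => (p.1.2, p.1.1, p.2)) (by fun_prop)
    _ ≤ ENNReal.ofReal (c0 d) * ∫⁻ τ in Ioi (0:ℝ), 2 * kap d * qAvg d τ z G := by
        refine mul_le_mul_right ?_ _
        exact setLIntegral_mono' measurableSet_Ioi fun τ hτ => inner_tau d G hG z hτ
    _ = _ := by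
        rw [lintegral_const_mul' _ _ (ENNReal.mul_ne_top (by simp) (kap_ne_top d))]; ring

/-- Hedberg inequality -/
lemma gPot_hedberg (d : ℕ) {q β : ℝ} (hq : 1 < q) (hβ : 1 < β) : ∃ C : ℝ≥0∞, C ≠ ⊤ ∧
    ∀ (G : Pt d → ℝ≥0∞), Measurable G → ∀ z, maxQ d G z ≠ ⊤ →
      gPot d G z ≤ C * (MorreyNorm d q β univ G ^ (1 / β) * maxQ d G z ^ (1 - 1 / β)) := by
  refine ⟨ENNReal.ofReal (c0 d) * (2 * kap d) * ENNReal.ofReal (1 + 1 / (β - 1)) *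
    (2 ^ (d + 1)) ^ (1 / β), ?_, ?_⟩
  · have : ((2:ℝ≥0∞) ^ (d + 1)) ^ (1 / β) ≠ ⊤ :=
      ENNReal.rpow_ne_top_of_nonneg (by positivity) (by finiteness)
    have := kap_ne_top d
    finiteness
  intro G hG z hM
  have := hedberg_int hβ (fun τ => qAvg d τ z G) (maxQ d G z)
    (2 ^ (d + 1) * MorreyNorm d q β univ G) hM
    (fun τ hτ => qAvg_le_maxQ hτ (self_mem_symQ hτ z))
    (fun τ hτ => (qAvg_le hq hβ G hG hτ z).trans (le_of_eq (by ring)))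
  calc _ ≤ _ := gPot_le d G hG z
    _ ≤ _ := mul_le_mul_right this _
    _ = _ := by
      rw [ENNReal.mul_rpow_of_nonneg _ _ (by positivity)]; ring

/-- smooth, compactly supported -/
def TestFn (d : ℕ) (h : Pt d → ℝ) : Prop := ContDiff ℝ (⊤ : ℕ∞) h ∧ HasCompactSupport h

lemma TestFn.dir {d : ℕ} {h : Pt d → ℝ} (hh : TestFn d h) (a : Pt d) :
    TestFn d (fun z => fderiv ℝ h z a) :=
  ⟨(hh.1.fderiv_right (m := (⊤ : ℕ∞)) (by simp)).clm_apply contDiff_const, hh.2.fderiv_apply (𝕜 := ℝ) a⟩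

lemma TestFn.time {d : ℕ} {h : Pt d → ℝ} (hh : TestFn d h) : TestFn d (timeDeriv d h) := hh.dir _
lemma TestFn.sp {d : ℕ} {h : Pt d → ℝ} (hh : TestFn d h) (i : Fin d) : TestFn d (spDeriv d i h) :=
  hh.dir _

lemma TestFn.diff {d : ℕ} {h : Pt d → ℝ} (hh : TestFn d h) : Differentiable ℝ h :=
  hh.1.differentiable (by simp)

lemma TestFn.cont {d : ℕ} {h : Pt d → ℝ} (hh : TestFn d h) : Continuous h := hh.1.continuous

lemma TestFn.add {d : ℕ} {h g : Pt d → ℝ} (hh : TestFn d h) (hg : TestFn d g) :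
    TestFn d (fun z => h z + g z) := ⟨hh.1.add hg.1, hh.2.add hg.2⟩

lemma TestFn.sum {d : ℕ} {ι : Type*} (s : Finset ι) (h : ι → Pt d → ℝ) (hh : ∀ i, TestFn d (h i)) :
    TestFn d (fun z => ∑ i ∈ s, h i z) := by
  classical
  induction s using Finset.induction_on with
  | empty =>
    simp only [Finset.sum_empty]
    exact ⟨contDiff_const, HasCompactSupport.zero⟩
  | insert a s ha ih =>
    simp only [Finset.sum_insert ha]
    exact (hh a).add ih

lemma TestFn.lap {d : ℕ} {h : Pt d → ℝ} (hh : TestFn d h) : TestFn d (lap d h) :=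
  TestFn.sum _ _ fun i => (hh.sp i).sp i

lemma TestFn.bdd {d : ℕ} {h : Pt d → ℝ} (hh : TestFn d h) : ∃ B : ℝ, ∀ z, |h z| ≤ B := by
  obtain ⟨C, hC⟩ := hh.2.exists_bound_of_continuous hh.cont
  exact ⟨C, hC⟩

lemma dir_comm {d : ℕ} {h : Pt d → ℝ} (hh : TestFn d h) (a b z : Pt d) :
    fderiv ℝ (fun z => fderiv ℝ h z a) z b = fderiv ℝ (fun z => fderiv ℝ h z b) z a := by
  have hs : IsSymmSndFDerivAt ℝ h z := by
    apply ContDiffAt.isSymmSndFDerivAt (n := 2) (contDiff_infty.1 hh.1 2).contDiffAt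
    rw [minSmoothness_of_isRCLikeNormedField]
  have hd : DifferentiableAt ℝ (fderiv ℝ h) z :=
    ((hh.1.fderiv_right (m := (⊤ : ℕ∞)) (by simp)).differentiable (by simp)) z
  have key : ∀ a b, fderiv ℝ (fun z => fderiv ℝ h z a) z b = fderiv ℝ (fderiv ℝ h) z b a := by
    intro a b
    rw [fderiv_clm_apply hd (differentiableAt_const a)]
    simp
  rw [key, key]
  exact hs.eq b a

lemma heat_comm {d : ℕ} {u : Pt d → ℝ} (hu : TestFn d u) (i : Fin d) (z : Pt d) :
    timeDeriv d (spDeriv d i u) z + lap d (spDeriv d i u) z =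
      spDeriv d i (fun z => timeDeriv d u z + lap d u z) z := by
  have e1 : spDeriv d i (fun z => timeDeriv d u z + lap d u z) z =
      spDeriv d i (timeDeriv d u) z + ∑ j, spDeriv d i (spDeriv d j (spDeriv d j u)) z := by
    have h1 : fderiv ℝ (fun z => timeDeriv d u z + lap d u z) z =
        fderiv ℝ (timeDeriv d u) z + fderiv ℝ (lap d u) z :=
      fderiv_fun_add (hu.time.diff z) (hu.lap.diff z)
    have h2 : fderiv ℝ (lap d u) z = ∑ j, fderiv ℝ (spDeriv d j (spDeriv d j u)) z :=
      fderiv_fun_sum fun j _ => ((hu.sp j).sp j).diff z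
    simp only [spDeriv] at h1 h2 ⊢
    rw [h1, h2]
    simp
  rw [e1]
  congr 1
  · exact dir_comm hu _ _ z
  · refine Finset.sum_congr rfl fun j _ => ?_
    have h3 : spDeriv d j (spDeriv d i u) = spDeriv d i (spDeriv d j u) := by
      ext y; exact dir_comm hu _ _ y
    rw [h3]
    exact dir_comm (hu.sp j) _ _ z

/-- Gaussian weight. -/
def gam (d : ℕ) (w : Ed d) : ℝ := Real.exp (-‖w‖ ^ 2 / 4)

lemma gam_pos (d : ℕ) (w : Ed d) : 0 < gam d w := Real.exp_pos _

lemma gam_cont (d : ℕ) : Continuous (gam d) := by unfold gam; fun_prop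

lemma gam_hasFDerivAt (d : ℕ) (w : Ed d) :
    HasFDerivAt (gam d) (gam d w • (-(1 / 2 : ℝ)) • innerSL ℝ w) w := by
  have h := ((hasStrictFDerivAt_norm_sq w).hasFDerivAt.const_mul (-(1 / 4) : ℝ)).exp
  have e : gam d = fun w => Real.exp (-(1 / 4) * ‖w‖ ^ 2) := by
    ext w; unfold gam; congr 1; ring
  rw [e]
  refine h.congr_fderiv ?_
  ext v
  simp only [ContinuousLinearMap.smul_apply, smul_eq_mul, nsmul_eq_mul]
  push_cast
  ring

lemma gam_fderiv (d : ℕ) (w : Ed d) (i : Fin d) :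
    fderiv ℝ (gam d) w (EuclideanSpace.single i 1) = -(w i / 2) * gam d w := by
  rw [(gam_hasFDerivAt d w).fderiv]
  simp [EuclideanSpace.inner_single_right]
  ring

lemma exp_integrable (d : ℕ) {b : ℝ} (hb : 0 < b) :
    Integrable (fun w : Ed d => Real.exp (-b * ‖w‖ ^ 2)) := by
  have h := GaussianFourier.integrable_cexp_neg_mul_sq_norm_add (V := Ed d) (b := (b : ℂ))
    (by simpa using hb) 0 0
  have h2 := h.norm
  refine h2.congr (Eventually.of_forall fun w => ?_)
  simp only [Complex.norm_exp]
  congr 1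
  simp [← Complex.ofReal_pow]

lemma gam1_integrable (d : ℕ) : Integrable (fun w : Ed d => (1 + ‖w‖) * gam d w) := by
  have h := (exp_integrable d (b := 1 / 8) (by norm_num)).const_mul 8
  refine h.mono' (by have := gam_cont d; exact (by fun_prop : Continuous _).aestronglyMeasurable)
    (Eventually.of_forall fun w => ?_)
  have h1 := gam_pos d w
  rw [Real.norm_eq_abs, abs_of_nonneg (by positivity)]
  have h2 : gam d w = Real.exp (-(1 / 8) * ‖w‖ ^ 2) * Real.exp (-(1 / 8) * ‖w‖ ^ 2) := by
    rw [← Real.exp_add, gam]; congr 1; ring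
  have h3 : (1 + ‖w‖) * Real.exp (-(1 / 8) * ‖w‖ ^ 2) ≤ 8 := by
    have h4 := Real.add_one_le_exp (1 / 8 * ‖w‖ ^ 2)
    rw [neg_mul, Real.exp_neg, ← div_eq_mul_inv, div_le_iff₀ (Real.exp_pos _)]
    nlinarith [sq_nonneg (‖w‖ - 1)]
  rw [h2, ← mul_assoc]
  gcongr

lemma abs_coord_le {d : ℕ} (w : Ed d) (i : Fin d) : |w i| ≤ ‖w‖ := by
  simpa using PiLp.norm_apply_le w i

/-- Anything bounded by `B (1+‖w‖) γ` is integrable. -/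
lemma integrable_of_gam {d : ℕ} {F : Ed d → ℝ} (hF : Continuous F) (B : ℝ)
    (h : ∀ w, |F w| ≤ B * ((1 + ‖w‖) * gam d w)) : Integrable F :=
  ((gam1_integrable d).const_mul B).mono' hF.aestronglyMeasurable (Eventually.of_forall h)

lemma gauss_ibp {d : ℕ} {φ : Ed d → ℝ} (hφ : ContDiff ℝ 1 φ) (i : Fin d) (B B' : ℝ)
    (hB : ∀ w, |φ w| ≤ B) (hB' : ∀ w, |fderiv ℝ φ w (EuclideanSpace.single i 1)| ≤ B') :
    ∫ w, gam d w * fderiv ℝ φ w (EuclideanSpace.single i 1) = ∫ w, (w i / 2) * gam d w * φ w := by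
  have hc := gam_cont d
  have hφc := hφ.continuous
  have hφd : Continuous (fun w => fderiv ℝ φ w (EuclideanSpace.single i 1)) :=
    (hφ.continuous_fderiv (by simp)).clm_apply continuous_const
  have := integral_mul_fderiv_eq_neg_fderiv_mul_of_integrable (μ := (volume : Measure (Ed d)))
    (f := gam d) (g := φ) (v := EuclideanSpace.single i 1) ?_ ?_ ?_ ?_ ?_
  · rw [this, ← integral_neg]
    congr 1; ext w
    rw [gam_fderiv]; ring
  · simp only [gam_fderiv]
    refine integrable_of_gam (by fun_prop) B fun w => ?_
    have h1 := gam_pos d w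
    have h2 := abs_coord_le w i
    have h3 := hB w
    rw [abs_mul, abs_mul, abs_neg, abs_div, abs_of_pos h1, abs_two]
    have : |w i| / 2 ≤ 1 + ‖w‖ := by linarith [norm_nonneg w, abs_nonneg (w i)]
    calc _ ≤ (1 + ‖w‖) * gam d w * B := by gcongr
      _ = _ := by ring
  · refine integrable_of_gam (by fun_prop) B' fun w => ?_
    have h1 := gam_pos d w
    rw [abs_mul, abs_of_pos h1]
    have : 1 ≤ 1 + ‖w‖ := by linarith [norm_nonneg w]
    have hB0 : 0 ≤ B' := (abs_nonneg _).trans (hB' w)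
    calc _ ≤ (1 * gam d w) * B' := by rw [one_mul]; gcongr; exact hB' w
      _ ≤ ((1 + ‖w‖) * gam d w) * B' := by gcongr
      _ = _ := by ring
  · refine integrable_of_gam (by fun_prop) B fun w => ?_
    have h1 := gam_pos d w
    rw [abs_mul, abs_of_pos h1]
    have : 1 ≤ 1 + ‖w‖ := by linarith [norm_nonneg w]
    have hB0 : 0 ≤ B := (abs_nonneg _).trans (hB w)
    calc _ ≤ (1 * gam d w) * B := by rw [one_mul]; gcongr; exact hB w
      _ ≤ ((1 + ‖w‖) * gam d w) * B := by gcongr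
      _ = _ := by ring
  · exact fun w _ => (gam_hasFDerivAt d w).differentiableAt
  · exact fun w _ => hφ.differentiable (by simp) w

/-- The point `(t + σ², x + σ w)`. -/
def hpt {d : ℕ} (z : Pt d) (σ : ℝ) (w : Ed d) : Pt d := (z.1 + σ ^ 2, z.2 + σ • w)

lemma hpt_cont {d : ℕ} (z : Pt d) : Continuous (fun p : ℝ × Ed d => hpt z p.1 p.2) := by
  unfold hpt; fun_prop

lemma hpt_cont_w {d : ℕ} (z : Pt d) (σ : ℝ) : Continuous (fun w => hpt z σ w) := by
  unfold hpt; fun_prop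

lemma hpt_cont_s {d : ℕ} (z : Pt d) (w : Ed d) : Continuous (fun σ => hpt z σ w) := by
  unfold hpt; fun_prop

lemma hpt_fderiv {d : ℕ} {g : Pt d → ℝ} (hg : TestFn d g) (z : Pt d) (σ : ℝ) (w : Ed d)
    (i : Fin d) :
    fderiv ℝ (fun w => g (hpt z σ w)) w (EuclideanSpace.single i 1) =
      σ * spDeriv d i g (hpt z σ w) := by
  have h1 : HasFDerivAt (fun w => hpt z σ w)
      ((0 : Ed d →L[ℝ] ℝ).prod (σ • ContinuousLinearMap.id ℝ (Ed d))) w := by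
    refine HasFDerivAt.prodMk (hasFDerivAt_const _ _) ?_
    exact ((hasFDerivAt_id w).const_smul σ).const_add z.2
  have h2 := ((hg.diff (hpt z σ w)).hasFDerivAt).comp w h1
  rw [show (fun w => g (hpt z σ w)) = g ∘ (fun w => hpt z σ w) from rfl, h2.fderiv]
  simp only [ContinuousLinearMap.comp_apply, ContinuousLinearMap.prod_apply, spDeriv]
  rw [← smul_eq_mul, ← map_smul]
  simp

lemma hpt_ibp {d : ℕ} {g : Pt d → ℝ} (hg : TestFn d g) (z : Pt d) (σ : ℝ) (i : Fin d) :
    σ * ∫ w, gam d w * spDeriv d i g (hpt z σ w) = ∫ w, (w i / 2) * gam d w * g (hpt z σ w) := by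
  obtain ⟨B, hB⟩ := hg.bdd
  obtain ⟨B', hB'⟩ := (hg.sp i).bdd
  have hc : ContDiff ℝ 1 (fun w => g (hpt z σ w)) := by
    have : ContDiff ℝ 1 g := (contDiff_infty.1 hg.1 1)
    refine this.comp ?_
    unfold hpt; fun_prop
  have h := gauss_ibp hc i B (|σ| * B') (fun w => hB _) (fun w => by
    rw [hpt_fderiv hg, abs_mul]; gcongr; exact hB' _)
  rw [← h, ← integral_const_mul]
  congr 1; ext w
  rw [hpt_fderiv hg]; ring

lemma fderiv_split {d : ℕ} (g : Pt d → ℝ) (p : Pt d) (a : ℝ) (w : Ed d) :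
    fderiv ℝ g p (a, w) = a * timeDeriv d g p + ∑ j, w j * spDeriv d j g p := by
  have h : ((a, w) : Pt d) = a • ((1 : ℝ), (0 : Ed d)) +
      ∑ j, w j • ((0 : ℝ), (EuclideanSpace.single j (1 : ℝ) : Ed d)) := by
    ext k
    · simp [Prod.fst_sum]
    · simp [Prod.snd_sum, Pi.single_apply]
  rw [h, map_add, map_sum]
  simp only [map_smul, smul_eq_mul, timeDeriv, spDeriv]

lemma hpt_integrable {d : ℕ} {g : Pt d → ℝ} (hg : TestFn d g) (z : Pt d) (σ : ℝ) :
    Integrable (fun w => gam d w * g (hpt z σ w)) := by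
  obtain ⟨B, hB⟩ := hg.bdd
  have hc := gam_cont d
  have h2 := hg.cont.comp (hpt_cont_w z σ)
  refine integrable_of_gam (hc.mul h2) B fun w => ?_
  have h1 := gam_pos d w
  rw [abs_mul, abs_of_pos h1]
  have : 1 ≤ 1 + ‖w‖ := by linarith [norm_nonneg w]
  have hB0 : 0 ≤ B := (abs_nonneg _).trans (hB z)
  calc _ ≤ (1 * gam d w) * B := by rw [one_mul]; gcongr; exact hB _
    _ ≤ ((1 + ‖w‖) * gam d w) * B := by gcongr
    _ = _ := by ring

lemma hpt_integrable1 {d : ℕ} {g : Pt d → ℝ} (hg : TestFn d g) (z : Pt d) (σ : ℝ) (i : Fin d) :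
    Integrable (fun w => gam d w * (w i * g (hpt z σ w))) := by
  obtain ⟨B, hB⟩ := hg.bdd
  have hc := gam_cont d
  have h2 := hg.cont.comp (hpt_cont_w z σ)
  refine integrable_of_gam (hc.mul ((by fun_prop : Continuous fun w : Ed d => w i).mul h2)) B
    fun w => ?_
  have h1 := gam_pos d w
  rw [abs_mul, abs_of_pos h1, abs_mul]
  have h3 := abs_coord_le w i
  have hB0 : 0 ≤ B := (abs_nonneg _).trans (hB z)
  have : |w i| ≤ 1 + ‖w‖ := by linarith
  calc _ ≤ gam d w * ((1 + ‖w‖) * B) := by gcongr; exact hB _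
    _ = _ := by ring

/-- Derivative of the heat flow of `v`. -/
lemma heat_hasDerivAt {d : ℕ} {v : Pt d → ℝ} (hv : TestFn d v) (z : Pt d) (σ₀ : ℝ) :
    HasDerivAt (fun σ => ∫ w, gam d w * v (hpt z σ w))
      (∫ w, gam d w * fderiv ℝ v (hpt z σ₀ w) (2 * σ₀, w)) σ₀ := by
  have hfc : Continuous (fderiv ℝ v) := hv.1.continuous_fderiv (by simp)
  obtain ⟨M, hM⟩ := (hv.2.fderiv (𝕜 := ℝ)).exists_bound_of_continuous hfc
  have hM0 : 0 ≤ M := (norm_nonneg _).trans (hM z)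
  have hc := gam_cont d
  refine (hasDerivAt_integral_of_dominated_loc_of_deriv_le
    (F := fun σ w => gam d w * v (hpt z σ w))
    (F' := fun σ w => gam d w * fderiv ℝ v (hpt z σ w) (2 * σ, w))
    (bound := fun w => (M * (2 * (|σ₀| + 1) + 1)) * ((1 + ‖w‖) * gam d w))
    (s := Metric.ball σ₀ 1) (Metric.ball_mem_nhds _ one_pos) ?_ ?_ ?_ ?_ ?_ ?_).2
  · exact Eventually.of_forall fun σ => (hpt_integrable hv z σ).aestronglyMeasurable
  · exact hpt_integrable hv z σ₀
  · have : Continuous fun w => fderiv ℝ v (hpt z σ₀ w) (2 * σ₀, w) :=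
      (hfc.comp (hpt_cont_w z σ₀)).clm_apply (by fun_prop)
    exact (hc.mul this).aestronglyMeasurable
  · refine Eventually.of_forall fun w σ hσ => ?_
    have h1 := gam_pos d w
    have hs : |σ| ≤ |σ₀| + 1 := by
      rw [Metric.mem_ball, Real.dist_eq] at hσ
      have := abs_sub_abs_le_abs_sub σ σ₀
      linarith
    have h2 : ‖((2 * σ, w) : Pt d)‖ ≤ (2 * (|σ₀| + 1) + 1) * (1 + ‖w‖) := by
      rw [Prod.norm_def]
      have hw := norm_nonneg w
      have h0 := abs_nonneg σ₀
      refine max_le ?_ ?_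
      · simp only [norm_mul, Real.norm_eq_abs, abs_two]
        nlinarith
      · simp only
        nlinarith
    rw [norm_mul, Real.norm_eq_abs, abs_of_pos h1]
    calc gam d w * ‖fderiv ℝ v (hpt z σ w) (2 * σ, w)‖
        ≤ gam d w * (M * ((2 * (|σ₀| + 1) + 1) * (1 + ‖w‖))) := by
          gcongr
          refine (ContinuousLinearMap.le_opNorm _ _).trans ?_
          gcongr
          exact hM _
      _ = _ := by ring
  · exact (gam1_integrable d).const_mul _
  · refine Eventually.of_forall fun w σ _ => ?_
    have h1 : HasDerivAt (fun σ => hpt z σ w) ((2 * σ, w) : Pt d) σ := by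
      have ha : HasDerivAt (fun σ : ℝ => z.1 + σ ^ 2) (2 * σ) σ := by
        simpa using (hasDerivAt_pow 2 σ).const_add z.1
      have hb : HasDerivAt (fun σ : ℝ => z.2 + σ • w) w σ := by
        simpa using ((hasDerivAt_id σ).smul_const w).const_add z.2
      exact ha.prodMk hb
    exact (((hv.diff (hpt z σ w)).hasFDerivAt).comp_hasDerivAt σ h1).const_mul _

lemma heat_deriv_eq {d : ℕ} {u : Pt d → ℝ} (hu : TestFn d u) (i : Fin d) (z : Pt d) (σ : ℝ) :
    ∫ w, gam d w * fderiv ℝ (spDeriv d i u) (hpt z σ w) (2 * σ, w) =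
      ∫ w, w i * gam d w * (timeDeriv d u (hpt z σ w) + lap d u (hpt z σ w)) := by
  set v := spDeriv d i u with hvdef
  have hv : TestFn d v := hu.sp i
  have hf : TestFn d (fun z => timeDeriv d u z + lap d u z) := hu.time.add hu.lap
  have e1 : ∀ w, gam d w * fderiv ℝ v (hpt z σ w) (2 * σ, w) =
      2 * σ * (gam d w * timeDeriv d v (hpt z σ w)) +
        ∑ j, gam d w * (w j * spDeriv d j v (hpt z σ w)) := by
    intro w
    rw [fderiv_split, mul_add, Finset.mul_sum]; ring
  simp_rw [e1]
  rw [integral_add ((hpt_integrable hv.time z σ).const_mul _)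
    (integrable_finsetSum _ fun j _ => hpt_integrable1 (hv.sp j) z σ j),
    integral_finsetSum _ (fun j _ => hpt_integrable1 (hv.sp j) z σ j), integral_const_mul]
  have e2 : ∀ j, ∫ w, gam d w * (w j * spDeriv d j v (hpt z σ w)) =
      2 * σ * ∫ w, gam d w * spDeriv d j (spDeriv d j v) (hpt z σ w) := by
    intro j
    rw [mul_assoc, hpt_ibp (hv.sp j) z σ j, ← integral_const_mul]
    congr 1; ext w; ring
  simp_rw [e2]
  rw [← Finset.mul_sum, ← integral_finsetSum _ (fun j _ => hpt_integrable ((hv.sp j).sp j) z σ),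
    ← mul_add, ← integral_add (hpt_integrable hv.time z σ)
      (integrable_finsetSum _ fun j _ => hpt_integrable ((hv.sp j).sp j) z σ)]
  have e3 : ∀ w, gam d w * timeDeriv d v (hpt z σ w) +
      ∑ j, gam d w * spDeriv d j (spDeriv d j v) (hpt z σ w) =
      gam d w * spDeriv d i (fun z => timeDeriv d u z + lap d u z) (hpt z σ w) := by
    intro w
    rw [← heat_comm hu i, ← Finset.mul_sum, ← mul_add]; rfl
  simp_rw [e3]
  rw [mul_assoc, hpt_ibp hf z σ i, ← integral_const_mul]
  congr 1; ext w; ring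

/-- Total Gaussian mass. -/
def gmass (d : ℕ) : ℝ := ∫ w, gam d w

lemma gmass_pos (d : ℕ) : 0 < gmass d := by
  have hi : Integrable (gam d) := by
    have := exp_integrable d (b := 1 / 4) (by norm_num)
    refine this.congr (Eventually.of_forall fun w => ?_)
    simp only [gam]; congr 1; ring
  unfold gmass
  rw [integral_pos_iff_support_of_nonneg (fun w => (gam_pos d w).le) hi]
  have : Function.support (gam d) = univ := by
    ext w; simp [(gam_pos d w).ne']
  rw [this]
  exact isOpen_univ.measure_pos _ univ_nonempty

lemma representation {d : ℕ} {u : Pt d → ℝ} (hu : TestFn d u) (i : Fin d) (z : Pt d) :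
    ENNReal.ofReal (gmass d) * ENNReal.ofReal |spDeriv d i u z| ≤
      gPot d (fun z => ENNReal.ofReal |timeDeriv d u z + lap d u z|) z := by
  set v := spDeriv d i u with hvdef
  have hv : TestFn d v := hu.sp i
  set f : Pt d → ℝ := fun z => timeDeriv d u z + lap d u z with hfdef
  have hf : TestFn d f := hu.time.add hu.lap
  set Φ : ℝ → ℝ := fun σ => ∫ w, gam d w * v (hpt z σ w) with hΦ
  set Ψ : ℝ → ℝ := fun σ => ∫ w, w i * gam d w * f (hpt z σ w) with hΨ
  have hd : ∀ σ, HasDerivAt Φ (Ψ σ) σ := by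
    intro σ
    have := heat_hasDerivAt hv z σ
    rwa [heat_deriv_eq hu i z σ] at this
  have hc := gam_cont d
  obtain ⟨B, hB⟩ := hf.bdd
  have hB0 : 0 ≤ B := (abs_nonneg _).trans (hB z)
  have hΨc : Continuous Ψ := by
    refine continuous_of_dominated (bound := fun w => B * ((1 + ‖w‖) * gam d w)) ?_ ?_ ?_ ?_
    · intro σ
      have h2 := hf.cont.comp (hpt_cont_w z σ)
      exact (((by fun_prop : Continuous fun w : Ed d => w i).mul hc).mul h2).aestronglyMeasurable
    · refine fun σ => Eventually.of_forall fun w => ?_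
      have h1 := gam_pos d w
      have h3 := abs_coord_le w i
      have : |w i| ≤ 1 + ‖w‖ := by linarith
      rw [Real.norm_eq_abs, abs_mul, abs_mul, abs_of_pos h1]
      calc _ ≤ (1 + ‖w‖) * gam d w * B := by gcongr; exact hB _
        _ = _ := by ring
    · exact (gam1_integrable d).const_mul _
    · exact Eventually.of_forall fun w => continuous_const.mul (hf.cont.comp (hpt_cont_s z w))
  obtain ⟨R, hR⟩ := hv.2.isBounded.subset_closedBall (0 : Pt d)
  obtain ⟨S, hS0, hS⟩ : ∃ S : ℝ, 0 ≤ S ∧ R < z.1 + S ^ 2 := by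
    refine ⟨|R| + |z.1| + 1, by positivity, ?_⟩
    nlinarith [abs_nonneg R, abs_nonneg z.1, le_abs_self R, neg_abs_le z.1]
  have hΦS : Φ S = 0 := by
    have : ∀ w, v (hpt z S w) = 0 := by
      intro w
      by_contra h
      have h1 := hR (subset_tsupport _ h)
      rw [Metric.mem_closedBall, dist_zero_right] at h1
      have h2 := (norm_fst_le (hpt z S w)).trans h1
      have h3 := (le_abs_self _).trans h2
      simp only [hpt] at h3
      linarith
    simp [hΦ, this]
  have hΦ0 : Φ 0 = gmass d * v z := by
    have : ∀ w, hpt z 0 w = z := by intro w; simp [hpt]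
    simp only [hΦ, this]
    rw [integral_mul_const]; rfl
  have hftc := intervalIntegral.integral_eq_sub_of_hasDerivAt (a := 0) (b := S)
    (fun σ _ => hd σ) (hΨc.intervalIntegrable _ _)
  rw [hΦS, hΦ0, zero_sub, intervalIntegral.integral_of_le hS0] at hftc
  rw [← ENNReal.ofReal_mul (gmass_pos d).le]
  have e : gmass d * |v z| = ‖∫ σ in Ioc 0 S, Ψ σ‖ := by
    rw [hftc, Real.norm_eq_abs, abs_neg, abs_mul, abs_of_pos (gmass_pos d)]
  rw [e, ofReal_norm]
  refine (enorm_integral_le_lintegral_enorm _).trans ?_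
  refine (lintegral_mono_set Ioc_subset_Ioi_self).trans ?_
  unfold gPot
  refine lintegral_mono fun σ => ?_
  refine (enorm_integral_le_lintegral_enorm _).trans ?_
  refine lintegral_mono fun w => ?_
  rw [enorm_mul]
  refine mul_le_mul' ?_ ?_
  · rw [← ofReal_norm]
    refine ENNReal.ofReal_le_ofReal ?_
    rw [norm_mul, Real.norm_eq_abs, Real.norm_eq_abs, abs_of_pos (gam_pos d w)]
    exact mul_le_mul_of_nonneg_right (abs_coord_le w i) (gam_pos d w).le
  · rw [← ofReal_norm]
    exact le_rfl

lemma pAvg_holder {d : ℕ} {ρ : ℝ} (z : Pt d) {F G : Pt d → ℝ≥0∞}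
    (hF : Measurable F) (hG : Measurable G) {a b : ℝ} (ha : 0 ≤ a) (hb : 0 ≤ b) (hab : a + b = 1) :
    pAvg d ρ z (fun w => F w ^ a * G w ^ b) ≤ pAvg d ρ z F ^ a * pAvg d ρ z G ^ b := by
  have h := ENNReal.lintegral_mul_norm_pow_le (μ := (volume (pCyl d ρ z))⁻¹ • volume.restrict (pCyl d ρ z))
    hF.aemeasurable hG.aemeasurable ha hb hab
  simp only [lintegral_smul_measure, smul_eq_mul] at h
  exact h

lemma grad_bound (d : ℕ) {q β : ℝ} (hq : 1 < q) (hβ : 1 < β) : ∃ D : ℝ≥0∞, D ≠ ⊤ ∧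
    ∀ (b : Pt d → Ed d) (u : Pt d → ℝ), TestFn d u → ∀ z,
      ENNReal.ofReal |∑ i : Fin d, b z i * spDeriv d i u z| ≤
        D * MorreyNorm d q β univ (fun z => ENNReal.ofReal |timeDeriv d u z + lap d u z|) ^ (1 / β) *
          (ENNReal.ofReal ‖b z‖ *
          maxQ d (fun z => ENNReal.ofReal |timeDeriv d u z + lap d u z|) z ^ (1 - 1 / β)) := by
  obtain ⟨C, hC, hH⟩ := gPot_hedberg d hq hβ
  have hZ0 : ENNReal.ofReal (gmass d) ≠ 0 := by simpa using gmass_pos d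
  have hZt : ENNReal.ofReal (gmass d) ≠ ⊤ := ENNReal.ofReal_ne_top
  refine ⟨d * ((ENNReal.ofReal (gmass d))⁻¹ * C), by finiteness, ?_⟩
  intro b u hu z
  have hf : TestFn d (fun z => timeDeriv d u z + lap d u z) := hu.time.add hu.lap
  set G : Pt d → ℝ≥0∞ := fun z => ENNReal.ofReal |timeDeriv d u z + lap d u z| with hG
  have hGm : Measurable G := by
    have := hf.cont
    exact (by fun_prop : Continuous fun z => |timeDeriv d u z + lap d u z|).measurable.ennreal_ofReal
  obtain ⟨B, hB⟩ := hf.bdd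
  have hM : maxQ d G z ≠ ⊤ := by
    refine ne_top_of_le_ne_top (ENNReal.ofReal_ne_top (r := B)) (maxQ_le fun r w hr _ =>
      qAvg_const_le (fun z => ENNReal.ofReal_le_ofReal (hB z)) hr w)
  set K := MorreyNorm d q β univ G
  set M := maxQ d G z
  have h1 : ∀ i, ENNReal.ofReal |spDeriv d i u z| ≤
      (ENNReal.ofReal (gmass d))⁻¹ * C * (K ^ (1 / β) * M ^ (1 - 1 / β)) := by
    intro i
    have h2 := (representation hu i z).trans (hH G hGm z hM)
    rw [mul_assoc]
    rw [mul_comm (ENNReal.ofReal (gmass d))] at h2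
    rw [mul_comm (ENNReal.ofReal (gmass d))⁻¹, ← div_eq_mul_inv]
    exact (ENNReal.le_div_iff_mul_le (Or.inl hZ0) (Or.inl hZt)).2 h2
  calc ENNReal.ofReal |∑ i : Fin d, b z i * spDeriv d i u z|
      ≤ ENNReal.ofReal (∑ i : Fin d, ‖b z‖ * |spDeriv d i u z|) := by
        refine ENNReal.ofReal_le_ofReal ((Finset.abs_sum_le_sum_abs _ _).trans ?_)
        refine Finset.sum_le_sum fun i _ => ?_
        rw [abs_mul]
        gcongr
        exact abs_coord_le _ i
    _ = ∑ i : Fin d, ENNReal.ofReal ‖b z‖ * ENNReal.ofReal |spDeriv d i u z| := by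
        rw [ENNReal.ofReal_sum_of_nonneg (fun i _ => by positivity)]
        refine Finset.sum_congr rfl fun i _ => ENNReal.ofReal_mul (norm_nonneg _)
    _ ≤ ∑ i : Fin d, ENNReal.ofReal ‖b z‖ *
          ((ENNReal.ofReal (gmass d))⁻¹ * C * (K ^ (1 / β) * M ^ (1 - 1 / β))) := by
        refine Finset.sum_le_sum fun i _ => ?_
        gcongr
        exact h1 i
    _ = _ := by
        simp only [Finset.sum_const, Finset.card_univ, Fintype.card_fin, nsmul_eq_mul]
        ring

lemma main_bound (d : ℕ) {q β : ℝ} (hq : 1 < q) (hβ : 1 < β) : ∃ N : ℝ≥0∞, N ≠ ⊤ ∧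
    ∀ b : Pt d → Ed d, Measurable b → ∀ u : Pt d → ℝ, TestFn d u →
        MorreyNorm d q β univ
            (fun z => ENNReal.ofReal |∑ i : Fin d, b z i * spDeriv d i u z|) ≤
          N * MorreyNorm d (β * q) 1 univ (fun z => ENNReal.ofReal ‖b z‖) *
            MorreyNorm d q β univ
              (fun z => ENNReal.ofReal |timeDeriv d u z + lap d u z|) := by
  obtain ⟨D, hD, hG⟩ := grad_bound d hq hβ
  obtain ⟨C, hC, hMM⟩ := maxQ_morrey d hq hβ
  have hq0 : 0 < q := by linarith
  have hβ0 : 0 < β := by linarith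
  have hθ : 0 ≤ 1 - 1 / β := by
    have : 1 / β ≤ 1 := by rw [div_le_one hβ0]; linarith
    linarith
  have hβi : 0 ≤ 1 / β := by positivity
  refine ⟨D * C ^ ((1 - 1 / β) * (1 / q)),
    ENNReal.mul_ne_top hD (ENNReal.rpow_ne_top_of_nonneg (by positivity) hC), ?_⟩
  intro b hb u hu
  have hf : TestFn d (fun z => timeDeriv d u z + lap d u z) := hu.time.add hu.lap
  have hfm : Measurable fun z => |timeDeriv d u z + lap d u z| := by
    have := hf.cont
    exact (by fun_prop : Continuous fun z => |timeDeriv d u z + lap d u z|).measurable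
  obtain ⟨B, hB⟩ := hf.bdd
  have hG := hG b u hu
  have hMM := hMM _ B hfm (fun z => abs_nonneg _) hB
  set G : Pt d → ℝ≥0∞ := fun z => ENNReal.ofReal |timeDeriv d u z + lap d u z|
  set K := MorreyNorm d q β univ G
  set Kb := MorreyNorm d (β * q) 1 univ (fun z => ENNReal.ofReal ‖b z‖) with hKb
  conv_lhs => unfold MorreyNorm
  refine iSup_le fun ρ => iSup_le fun hρ => iSup_le fun z => iSup_le fun _ => ?_
  simp only [indicator_univ]
  have hbq : 1 < β * q := by nlinarith
  have hbm : Measurable fun z => ENNReal.ofReal ‖b z‖ := hb.norm.ennreal_ofReal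
  set A := D * K ^ (1 / β) with hA
  have s1 : pAvg d ρ z (fun w => ENNReal.ofReal |∑ i : Fin d, b w i * spDeriv d i u w| ^ q) ≤
      A ^ q * pAvg d ρ z (fun w => (ENNReal.ofReal ‖b w‖ ^ (β * q)) ^ (1 / β) *
        (maxQ d G w ^ q) ^ (1 - 1 / β)) := by
    have hm : Measurable (fun w => (ENNReal.ofReal ‖b w‖ ^ (β * q)) ^ (1 / β) *
        (maxQ d G w ^ q) ^ (1 - 1 / β)) :=
      ((hbm.pow_const _).pow_const _).mul (((measurable_maxQ d G).pow_const _).pow_const _)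
    unfold pAvg
    rw [mul_left_comm, ← lintegral_const_mul _ hm]
    gcongr with w
    refine (ENNReal.rpow_le_rpow (hG w) hq0.le).trans (le_of_eq ?_)
    rw [ENNReal.mul_rpow_of_nonneg _ _ hq0.le, ENNReal.mul_rpow_of_nonneg (ENNReal.ofReal ‖b w‖) _ hq0.le]
    simp only [← ENNReal.rpow_mul]
    congr 3
    · field_simp
    · ring
  have s2 := pAvg_holder (ρ := ρ) z (hbm.pow_const (β * q)) ((measurable_maxQ d G).pow_const q)
    hβi hθ (by ring)
  have s3 := pAvg_le_morrey (β := 1) hbq (fun z => ENNReal.ofReal ‖b z‖) hρ z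
  rw [← hKb] at s3
  have s4 := hMM ρ z hρ
  have s5 : pAvg d ρ z (fun w => ENNReal.ofReal |∑ i : Fin d, b w i * spDeriv d i u w| ^ q) ≤
      A ^ q * (((ENNReal.ofReal (ρ ^ (-1 : ℝ)) * Kb) ^ (β * q)) ^ (1 / β) *
        (C * (ENNReal.ofReal (ρ ^ (-β)) * K) ^ q) ^ (1 - 1 / β)) := by
    refine s1.trans ?_
    gcongr
    refine s2.trans ?_
    gcongr
  have s6 : (pAvg d ρ z (fun w =>
      ENNReal.ofReal |∑ i : Fin d, b w i * spDeriv d i u w| ^ q)) ^ (1 / q) ≤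
      A * ((ENNReal.ofReal (ρ ^ (-1 : ℝ)) * Kb) *
        (C ^ ((1 - 1 / β) * (1 / q)) * (ENNReal.ofReal (ρ ^ (-β)) ^ (1 - 1 / β) * K ^ (1 - 1 / β)))) := by
    have hqi : 0 ≤ 1 / q := by positivity
    refine (ENNReal.rpow_le_rpow s5 hqi).trans (le_of_eq ?_)
    rw [ENNReal.mul_rpow_of_nonneg _ _ hqi, ENNReal.mul_rpow_of_nonneg _ _ hqi,
      ENNReal.mul_rpow_of_nonneg C _ hθ, ENNReal.mul_rpow_of_nonneg _ _ hqi,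
      ← ENNReal.mul_rpow_of_nonneg _ _ hθ]
    simp only [← ENNReal.rpow_mul]
    have e1 : q * (1 / q) = 1 := by field_simp
    have e2 : β * q * (1 / β) * (1 / q) = 1 := by field_simp
    have e3 : q * (1 - 1 / β) * (1 / q) = 1 - 1 / β := by field_simp
    have e2' : β * q * (1 / β * (1 / q)) = 1 := by field_simp
    have e3' : q * ((1 - 1 / β) * (1 / q)) = 1 - 1 / β := by field_simp
    simp only [e1, e2, e3, e2', e3', ENNReal.rpow_one]
  have s7 : ENNReal.ofReal (ρ ^ β) * (ENNReal.ofReal (ρ ^ (-1 : ℝ)) *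
      ENNReal.ofReal (ρ ^ (-β)) ^ (1 - 1 / β)) = 1 := by
    rw [ENNReal.ofReal_rpow_of_pos (by positivity), ← ENNReal.ofReal_mul (by positivity),
      ← ENNReal.ofReal_mul (by positivity), ← Real.rpow_mul hρ.le, ← Real.rpow_add hρ,
      ← Real.rpow_add hρ]
    have : β + (-1 + -β * (1 - 1 / β)) = 0 := by field_simp; ring
    rw [this]; simp
  have s8 : K ^ (1 / β) * K ^ (1 - 1 / β) = K := by
    rw [← ENNReal.rpow_add_of_nonneg _ _ hβi hθ]; simp
  calc _ ≤ ENNReal.ofReal (ρ ^ β) * (A * ((ENNReal.ofReal (ρ ^ (-1 : ℝ)) * Kb) *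
        (C ^ ((1 - 1 / β) * (1 / q)) *
          (ENNReal.ofReal (ρ ^ (-β)) ^ (1 - 1 / β) * K ^ (1 - 1 / β))))) := by gcongr
    _ = (ENNReal.ofReal (ρ ^ β) * (ENNReal.ofReal (ρ ^ (-1 : ℝ)) *
      ENNReal.ofReal (ρ ^ (-β)) ^ (1 - 1 / β))) * (D * C ^ ((1 - 1 / β) * (1 / q)) * Kb *
        (K ^ (1 / β) * K ^ (1 - 1 / β))) := by rw [hA]; ring
    _ = _ := by rw [s7, s8, one_mul]

/-- Remark 3.6, (3.4): if `1 < q < d+2`, `β ∈ (1,(d+2)/q]`, then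
`‖bⁱ D_i u‖_{E_{q,β}} ≤ N ‖|b|‖_{E_{βq,1}} ‖∂_t u + Δu‖_{E_{q,β}}`. -/
theorem stmt8 (d : ℕ) (hd : 1 ≤ d) (q β : ℝ) (hq : 1 < q) (hq' : q < (d : ℝ) + 2)
    (hβ : 1 < β) (hβ' : β ≤ ((d : ℝ) + 2) / q) :
    ∃ N : ℝ, 0 < N ∧ ∀ b : Pt d → Ed d, Measurable b →
      ∀ u : Pt d → ℝ, ContDiff ℝ (⊤ : ℕ∞) u → HasCompactSupport u →
        MorreyNorm d q β univ
            (fun z => ENNReal.ofReal |∑ i : Fin d, b z i * spDeriv d i u z|) ≤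
          ENNReal.ofReal N * MorreyNorm d (β * q) 1 univ (fun z => ENNReal.ofReal ‖b z‖) *
            MorreyNorm d q β univ
              (fun z => ENNReal.ofReal |timeDeriv d u z + lap d u z|) := by
  obtain ⟨N, hN, h⟩ := main_bound d hq hβ
  refine ⟨N.toReal + 1, by positivity, ?_⟩
  intro b hb u hu hc
  refine (h b hb u ⟨hu, hc⟩).trans ?_
  gcongr
  rw [← ENNReal.ofReal_toReal hN]
  exact ENNReal.ofReal_le_ofReal (by simp)
end
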